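/- arXiv:2008.10475 — 7 statements merged into one kernel-verified Lean document; each statement's English description precedes it below -/
import Mathlib

section
/- There exists a 2-tree, i.e., a graph obtained from a single edge by repeatedly attaching a new vertex to an existing edge, that does not admit a mixed 1-stack 1-queue layout. -/
/-- Vertices for the graphs `G(k,ℓ)`: two base vertices and, for each step `k`,
each oriented edge `(u,v)` and each index `i : Fin ℓ`, a potential attached vertex. -/
inductive PV (ℓ : ℕ) : Type where
  | A : PV ℓ
  | B : PV ℓ
  | att : ℕ → PV ℓ → PV ℓ → Fin ℓ → PV ℓ

/-- The (canonically oriented) edges of `G(k,ℓ)`: `G(1,ℓ)` is the single edge `(A,B)`,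
and for `k > 1`, `G(k,ℓ)` is obtained from `G(k-1,ℓ)` by attaching `ℓ` new vertices
to each of its edges. -/
def Gedges (ℓ : ℕ) : ℕ → Set (PV ℓ × PV ℓ)
  | 0 => ∅
  | 1 => {p | p = (PV.A, PV.B)}
  | (k + 2) => Gedges ℓ (k + 1) ∪
      {p | ∃ u v, ∃ i : Fin ℓ, (u, v) ∈ Gedges ℓ (k + 1) ∧
        (p = (PV.att (k + 2) u v i, u) ∨ p = (PV.att (k + 2) u v i, v))}

/-- The graph `G(k,ℓ)`. -/
def Gkl (k ℓ : ℕ) : SimpleGraph (PV ℓ) :=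
  SimpleGraph.fromEdgeSet ((fun p => s(p.1, p.2)) '' Gedges ℓ k)

/-- The graph `Ḡ(k,ℓ)` induced by the edges of `G(k,ℓ)` that are not in `G(k-1,ℓ)`. -/
def Gbar (k ℓ : ℕ) : SimpleGraph (PV ℓ) :=
  SimpleGraph.fromEdgeSet ((fun p => s(p.1, p.2)) '' (Gedges ℓ k \ Gedges ℓ (k - 1)))

/-- A mixed 1-stack 1-queue layout of a graph `G`: a strict total (linear) order `lt`
on the vertices together with an assignment of each edge to the stack (`isStack e`)
or to the queue (`¬ isStack e`), such that no two stack-edges cross and no two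
queue-edges nest. -/
structure MixedLayout {V : Type} (G : SimpleGraph V) where
  lt : V → V → Prop
  isSTO : IsStrictTotalOrder V lt
  isStack : Sym2 V → Prop
  noCross : ∀ a b c d : V, G.Adj a b → G.Adj c d →
    isStack s(a, b) → isStack s(c, d) → ¬(lt a c ∧ lt c b ∧ lt b d)
  noNest : ∀ a b c d : V, G.Adj a b → G.Adj c d →
    ¬isStack s(a, b) → ¬isStack s(c, d) → ¬(lt a c ∧ lt c d ∧ lt d b)

/-- `{a,b}` is an edge of the subgraph `H` that is a stack-edge in the layout `L`. -/
def SEdgeIn {V : Type} {G : SimpleGraph V} (L : MixedLayout G) (H : SimpleGraph V)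
    (a b : V) : Prop :=
  H.Adj a b ∧ L.isStack s(a, b)

/-- `{a,b}` is an edge of the subgraph `H` that is a queue-edge in the layout `L`. -/
def QEdgeIn {V : Type} {G : SimpleGraph V} (L : MixedLayout G) (H : SimpleGraph V)
    (a b : V) : Prop :=
  H.Adj a b ∧ ¬L.isStack s(a, b)

/-- `x` is a stack-attachment of the edge `{u,v}`: both `{x,u}` and `{x,v}` are
stack-edges. -/
def StackAtt {V : Type} {G : SimpleGraph V} (L : MixedLayout G) (x u v : V) : Prop :=
  SEdgeIn L G x u ∧ SEdgeIn L G x v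

/-- `x` is a queue-attachment of the edge `{u,v}`: both `{x,u}` and `{x,v}` are
queue-edges. -/
def QueueAtt {V : Type} {G : SimpleGraph V} (L : MixedLayout G) (x u v : V) : Prop :=
  QEdgeIn L G x u ∧ QEdgeIn L G x v

/-- `x` is a mixed-attachment of the edge `{u,v}`: one of `{x,u}`, `{x,v}` is a
stack-edge and the other is a queue-edge. -/
def MixedAtt {V : Type} {G : SimpleGraph V} (L : MixedLayout G) (x u v : V) : Prop :=
  (SEdgeIn L G x u ∧ QEdgeIn L G x v) ∨ (QEdgeIn L G x u ∧ SEdgeIn L G x v)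

/-- `x` is one of the vertices of `Ḡ(k,ℓ)` attached to the edge `{u,v}`, i.e. both
`{x,u}` and `{x,v}` are edges of `Ḡ(k,ℓ)`. -/
def AttachedAt (ℓ k : ℕ) (x u v : PV ℓ) : Prop :=
  (Gbar k ℓ).Adj x u ∧ (Gbar k ℓ).Adj x v

/-- A smiley face `⟨a,b,u,v,c,d⟩` formed by vertices and edges of the subgraph `H`
in the layout `L`: `a ≺ b ≺ u ≺ v ≺ c ≺ d`, the edges `{a,b}`, `{c,d}`, `{a,d}` of `H`
are queue-edges and the edge `{u,v}` of `H` is a stack-edge. -/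
def Smiley {V : Type} {G : SimpleGraph V} (L : MixedLayout G) (H : SimpleGraph V)
    (a b u v c d : V) : Prop :=
  L.lt a b ∧ L.lt b u ∧ L.lt u v ∧ L.lt v c ∧ L.lt c d ∧
  QEdgeIn L H a b ∧ QEdgeIn L H c d ∧ QEdgeIn L H a d ∧ SEdgeIn L H u v

/-- `G` is a 2-tree, with the vertices `0, 1, …, n-1` of `Fin n` listed in
construction order: the vertices `0` and `1` are joined by an edge, and every
vertex `i ≥ 2` is attached to an edge `{f i, g i}` of the previously built graph
(`f i, g i < i`); the edges of `G` are exactly the initial edge `{0,1}` together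
with the attachment edges `{i, f i}` and `{i, g i}` for `i ≥ 2`. -/
def IsTwoTree {n : ℕ} (G : SimpleGraph (Fin n)) : Prop :=
  2 ≤ n ∧
  ∃ f g : Fin n → Fin n,
    (∀ i : Fin n, 2 ≤ (i : ℕ) →
      (f i : ℕ) < (i : ℕ) ∧ (g i : ℕ) < (i : ℕ) ∧ G.Adj (f i) (g i)) ∧
    ∀ a b : Fin n, G.Adj a b ↔
      (((a : ℕ) = 0 ∧ (b : ℕ) = 1) ∨ ((a : ℕ) = 1 ∧ (b : ℕ) = 0) ∨
        (2 ≤ (a : ℕ) ∧ (b = f a ∨ b = g a)) ∨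
        (2 ≤ (b : ℕ) ∧ (a = f b ∨ a = g b)))

/-- An abstract mixed layout in which every edge has infinitely many attachments: `S` and `Q` are
the stack edges and the queue edges of a graph on a linearly ordered vertex set. -/
structure AttachClosedLayout {α : Type} [LinearOrder α] (S Q : α → α → Prop) : Prop where
  symm_stack : ∀ {a b}, S a b → S b a
  symm_queue : ∀ {a b}, Q a b → Q b a
  noCross : ∀ {a b c d}, S a b → S c d → ¬(a < c ∧ c < b ∧ b < d)
  noNest : ∀ {a b c d}, Q a b → Q c d → ¬(a < c ∧ c < d ∧ d < b)
  attach : ∀ {u v}, S u v ∨ Q u v → {x | (S u x ∨ Q u x) ∧ (S v x ∨ Q v x)}.Infinite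

namespace AttachClosedLayout

variable {α : Type} [LinearOrder α] {S Q : α → α → Prop}

lemma dual (h : AttachClosedLayout S Q) : AttachClosedLayout (α := αᵒᵈ) S Q where
  symm_stack := h.symm_stack
  symm_queue := h.symm_queue
  noCross h₁ h₂ h₃ := h.noCross (h.symm_stack h₂) (h.symm_stack h₁) ⟨h₃.2.2, h₃.2.1, h₃.1⟩
  noNest h₁ h₂ h₃ := h.noNest (h.symm_queue h₁) (h.symm_queue h₂) ⟨h₃.2.2, h₃.2.1, h₃.1⟩
  attach := h.attach

/-- Every edge has three attachments of the same type that are not separated by any vertex of a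
given finite set. -/
lemma exists_triple (h : AttachClosedLayout S Q) (F : Finset α) {u v : α} (huv : S u v ∨ Q u v) :
    ∃ x y z, x < y ∧ y < z ∧ (∀ w ∈ F, w < x ∨ z < w) ∧
      (S u x ∧ S u y ∧ S u z ∨ Q u x ∧ Q u y ∧ Q u z) ∧
      (S v x ∧ S v y ∧ S v z ∨ Q v x ∧ Q v y ∧ Q v z) := by
  classical
  have hinf := (h.attach huv).sdiff F.finite_toSet
  let A := {x | (S u x ∨ Q u x) ∧ (S v x ∨ Q v x)} \ (F : Set α)
  have := hinf.to_subtype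
  obtain ⟨c, hc⟩ := Finite.exists_infinite_fiber
    (fun x : A => (decide (S u x), decide (S v x), fun w : F => decide (w.1 < x.1)))
  obtain ⟨t, ht, htc⟩ := (Set.infinite_coe_iff.1 hc).exists_subset_card_eq 3
  let o := t.orderEmbOfFin htc
  have ho : ∀ i, o i ∈ t := t.orderEmbOfFin_mem htc
  have hmem : ∀ i, (o i).1 ∈ A := fun i => (o i).2
  have heq : ∀ i, _ = c := fun i => ht (ho i)
  have h01 : (o 0).1 < (o 1).1 := o.strictMono (by decide)
  have h12 : (o 1).1 < (o 2).1 := o.strictMono (by decide)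
  have key : ∀ i j, (S u (o i) ↔ S u (o j)) ∧ (S v (o i) ↔ S v (o j)) ∧
      ∀ w ∈ F, (w < (o i).1 ↔ w < (o j).1) := by
    intro i j
    have e := (heq i).trans (heq j).symm
    simp only [Prod.mk.injEq, decide_eq_decide, funext_iff, Subtype.forall] at e
    exact e
  refine ⟨o 0, o 1, o 2, h01, h12, fun w hw => ?_, ?_, ?_⟩
  · have hne : w ≠ o 2 := fun e => (hmem 2).2 (e ▸ hw)
    rcases lt_or_gt_of_ne hne with hlt | hlt
    · exact .inl (((key 0 2).2.2 w hw).2 hlt)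
    · exact .inr hlt
  · have := (hmem 0).1.1
    have := (hmem 1).1.1
    have := (hmem 2).1.1
    have := (key 0 1).1
    have := (key 0 2).1
    tauto
  · have := (hmem 0).1.2
    have := (hmem 1).1.2
    have := (hmem 2).1.2
    have := (key 0 1).2.1
    have := (key 0 2).2.1
    tauto

/-- The seven types of attachments that can occur three times at the same edge. -/
lemma exists_oriented_triple (h : AttachClosedLayout S Q) (F : Finset α) {u v : α} (huv : u < v)
    (he : S u v ∨ Q u v) :
    ∃ x y z, x < y ∧ y < z ∧ (∀ w ∈ F, w < x ∨ z < w) ∧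
      ((z < u ∧ S x u ∧ S y u ∧ S z u ∧ Q x v ∧ Q y v ∧ Q z v) ∨
       (z < u ∧ Q x u ∧ Q y u ∧ Q z u ∧ S x v ∧ S y v ∧ S z v) ∨
       (u < x ∧ z < v ∧ S u x ∧ S u y ∧ S u z ∧ Q x v ∧ Q y v ∧ Q z v) ∨
       (u < x ∧ z < v ∧ Q u x ∧ Q u y ∧ Q u z ∧ S x v ∧ S y v ∧ S z v) ∨
       (u < x ∧ z < v ∧ Q u x ∧ Q u y ∧ Q u z ∧ Q x v ∧ Q y v ∧ Q z v) ∨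
       (v < x ∧ S u x ∧ S u y ∧ S u z ∧ Q v x ∧ Q v y ∧ Q v z) ∨
       (v < x ∧ Q u x ∧ Q u y ∧ Q u z ∧ S v x ∧ S v y ∧ S v z)) := by
  obtain ⟨x, y, z, hxy, hyz, hF, hu, hv⟩ := h.exists_triple (insert u (insert v F)) he
  simp only [Finset.forall_mem_insert] at hF
  obtain ⟨h₁, h₂, hF⟩ := hF
  refine ⟨x, y, z, hxy, hyz, hF, ?_⟩
  have hS := @h.noCross
  have hQ := @h.noNest
  have sS := @h.symm_stack
  have sQ := @h.symm_queue
  rcases h₁ with h₁ | h₁ <;> rcases h₂ with h₂ | h₂ <;> rcases hu with hu | hu <;>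
    rcases hv with hv | hv <;> grind

lemma false_of_two_mixed_fans_over_stack (h : AttachClosedLayout S Q) {a b c d e f : α}
    (hab : a < b) (hbc : b < c) (hcd : c < d)
    (hde : d < e) (hef : e < f) (qad : Q a d) (saf : S a f) (sbe : S b e) (qbf : Q b f)
    (sce : S c e) : False := by
  obtain ⟨x, y, z, hxy, hyz, hF, H⟩ := h.exists_oriented_triple {a, b, d, f} (hcd.trans hde)
    (.inl sce)
  have hS := @h.noCross
  have hQ := @h.noNest
  simp only [Finset.forall_mem_insert, Finset.mem_singleton, forall_eq] at hF
  grind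

lemma false_of_mixed_fan_over_stack (h : AttachClosedLayout S Q) {a b c d e : α} (hab : a < b)
    (hbc : b < c) (hcd : c < d)
    (hde : d < e) (sad : S a d) (qae : Q a e) (sbc : S b c) : False := by
  obtain ⟨x, y, z, hxy, hyz, hF, H⟩ := h.exists_oriented_triple {a, d, e} hbc (.inl sbc)
  have hS := @h.noCross
  have hQ := @h.noNest
  simp only [Finset.forall_mem_insert, Finset.mem_singleton, forall_eq] at hF
  grind

lemma false_of_crossed_stack_queue_fans (h : AttachClosedLayout S Q) {a b c d e : α} (hab : a < b)
    (hbc : b < c) (hcd : c < d)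
    (hde : d < e) (sad : S a d) (qae : Q a e) (sbd : S b d) (qce : Q c e) (qde : Q d e) :
    False := by
  obtain ⟨x, y, z, hxy, hyz, hF, H⟩ := h.exists_oriented_triple {a, b, d} (hcd.trans hde) (.inr qce)
  have hS := @h.noCross
  have hQ := @h.noNest
  simp only [Finset.forall_mem_insert, Finset.mem_singleton, forall_eq] at hF
  have k₀ : x < a → Q x c → S x e → False := fun hxa q s =>
    h.false_of_two_mixed_fans_over_stack hxa hab hbc hcd hde q s sad qae sbd
  have k₁ : a < x → x < c → S x c → False := fun hax hxc s =>
    h.false_of_mixed_fan_over_stack hax hxc hcd hde sad qae s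
  have k₂ : c < x → x < d → S c x → False := fun hcx hxd s =>
    h.false_of_mixed_fan_over_stack (hab.trans hbc) hcx hxd hde sad qae s
  grind

lemma false_of_mixed_fan_over_two_stacks (h : AttachClosedLayout S Q) {a b c d e f : α}
    (hab : a < b) (hbc : b < c) (hcd : c < d)
    (hde : d < e) (hef : e < f) (qae : Q a e) (saf : S a f) (sbc : S b c) (sdf : S d f) :
    False := by
  obtain ⟨x, y, z, hxy, hyz, hF, H⟩ := h.exists_oriented_triple {a, d, e, f} hbc (.inl sbc)
  have hS := @h.noCross
  have hQ := @h.noNest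
  simp only [Finset.forall_mem_insert, Finset.mem_singleton, forall_eq] at hF
  grind

lemma false_of_interleaved_mixed_pairs (h : AttachClosedLayout S Q) {a b c d e : α} (hab : a < b)
    (hbc : b < c) (hcd : c < d)
    (hde : d < e) (qad : Q a d) (sae : S a e) (qbd : Q b d) (sce : S c e) : False := by
  obtain ⟨x, y, z, hxy, hyz, hF, H⟩ := h.exists_oriented_triple {a, c, e} (hbc.trans hcd) (.inr qbd)
  have hS := @h.noCross
  have hQ := @h.noNest
  simp only [Finset.forall_mem_insert, Finset.mem_singleton, forall_eq] at hF
  have k₀ : z < b → S x b → Q x d → S y b → Q z d → False := fun hzb s q s' q' =>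
    h.false_of_crossed_stack_queue_fans hxy hyz hzb (hbc.trans hcd) s q s' q' qbd
  have k₁ : b < x → x < c → S b x → False := fun hbx hxc s =>
    h.false_of_mixed_fan_over_two_stacks hab hbx hxc hcd hde qad sae s sce
  have k₂ : d < x → S d z → Q b z → S d y → Q b x → False := fun hdx s q s' q' =>
    h.dual.false_of_crossed_stack_queue_fans hyz hxy hdx (hbc.trans hcd) (h.symm_stack s)
      (h.symm_queue q) (h.symm_stack s')
      (h.symm_queue q') (h.symm_queue qbd)
  grind

lemma false_of_mixed_fan_queue (h : AttachClosedLayout S Q) {a b c d : α} (hab : a < b)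
    (hbc : b < c) (hcd : c < d)
    (sac : S a c) (qad : Q a d) (qbd : Q b d) : False := by
  obtain ⟨x, y, z, hxy, hyz, hF, H⟩ := h.exists_oriented_triple {a, c} (hbc.trans hcd) (.inr qbd)
  have hS := @h.noCross
  have hQ := @h.noNest
  simp only [Finset.forall_mem_insert, Finset.mem_singleton, forall_eq] at hF
  have k₀ : z < b → Q x b → S x d → Q y b → S z d → False := fun hzb q s q' s' =>
    h.false_of_interleaved_mixed_pairs hxy hyz hzb (hbc.trans hcd) q s q' s'
  have k₁ : a < x → x < b → S x b → False := fun hax hxb s =>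
    h.false_of_mixed_fan_over_stack hax hxb hbc hcd sac qad s
  have k₂ : b < x → x < c → S b x → False := fun hbx hxc s =>
    h.false_of_mixed_fan_over_stack hab hbx hxc hcd sac qad s
  have k₃ : d < x → S d z → Q b z → S d y → Q b x → False := fun hdx s q s' q' =>
    h.dual.false_of_crossed_stack_queue_fans hyz hxy hdx (hbc.trans hcd) (h.symm_stack s)
      (h.symm_queue q) (h.symm_stack s')
      (h.symm_queue q') (h.symm_queue qbd)
  grind

lemma false_of_queue_fan (h : AttachClosedLayout S Q) {a b c : α} (hab : a < b) (hbc : b < c)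
    (qab : Q a b) (qac : Q a c) : False := by
  obtain ⟨x, y, z, hxy, hyz, -, H⟩ := h.exists_oriented_triple ∅ hab (.inr qab)
  have hQ := @h.noNest
  have k₀ : z < a → S x a → Q x b → S y a → Q z b → False := fun hza s q s' q' =>
    h.false_of_crossed_stack_queue_fans hxy hyz hza hab s q s' q' qab
  have k₁ : z < a → Q x a → S x b → Q y a → S z b → False := fun hza q s q' s' =>
    h.false_of_interleaved_mixed_pairs hxy hyz hza hab q s q' s'
  have k₂ : a < x → y < b → S x b → Q a y → False := fun hax hyb s q =>
    h.dual.false_of_mixed_fan_queue hyb hxy hax (h.symm_stack s) (h.symm_queue qab) (h.symm_queue q)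
  have k₃ : b < x → S b z → Q a z → S b y → Q a x → False := fun hbx s q s' q' =>
    h.dual.false_of_crossed_stack_queue_fans hyz hxy hbx hab (h.symm_stack s) (h.symm_queue q)
      (h.symm_stack s')
      (h.symm_queue q') (h.symm_queue qab)
  have k₄ : b < x → Q b z → S a z → Q b y → S a x → False := fun hbx q s q' s' =>
    h.dual.false_of_interleaved_mixed_pairs hyz hxy hbx hab (h.symm_queue q) (h.symm_stack s)
      (h.symm_queue q')
      (h.symm_stack s')
  grind

lemma false_of_edge (h : AttachClosedLayout S Q) {a b : α} (hab : a < b)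
    (he : S a b ∨ Q a b) : False := by
  obtain ⟨x, y, z, hxy, hyz, -, H⟩ := h.exists_oriented_triple ∅ hab he
  have k₀ : z < a → S x a → Q x b → Q y b → False := fun hza s q q' =>
    h.false_of_mixed_fan_queue hxy (hyz.trans hza) hab s q q'
  have k₁ : z < a → Q x a → S x b → Q y a → S z b → False := fun hza q s q' s' =>
    h.false_of_interleaved_mixed_pairs hxy hyz hza hab q s q' s'
  have k₂ : a < x → Q a x → Q a y → False := fun hax q q' => h.false_of_queue_fan hax hxy q q'
  have k₃ : z < b → Q z b → Q y b → False := fun hzb q q' =>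
    h.dual.false_of_queue_fan hzb hyz (h.symm_queue q) (h.symm_queue q')
  have k₄ : b < x → Q b z → S a z → Q b y → S a x → False := fun hbx q s q' s' =>
    h.dual.false_of_interleaved_mixed_pairs hyz hxy hbx hab (h.symm_queue q) (h.symm_stack s)
      (h.symm_queue q')
      (h.symm_stack s')
  have k₅ : b < x → S b z → Q a z → Q a y → False := fun hbx s q q' =>
    h.dual.false_of_mixed_fan_queue hyz (hbx.trans hxy) hab (h.symm_stack s) (h.symm_queue q)
      (h.symm_queue q')
  grind

end AttachClosedLayout

namespace MixedLayout

lemma isEmpty_of_infinite_common_neighbors {V : Type} {G : SimpleGraph V} {u v : V}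
    (huv : G.Adj u v) (hG : ∀ u v, G.Adj u v → {x | G.Adj u x ∧ G.Adj v x}.Infinite) :
    IsEmpty (MixedLayout G) := by
  classical
  refine ⟨fun L => ?_⟩
  have := L.isSTO
  let : LinearOrder V := linearOrderOfSTO L.lt
  have h : AttachClosedLayout (fun a b => G.Adj a b ∧ L.isStack s(a, b))
      (fun a b => G.Adj a b ∧ ¬ L.isStack s(a, b)) :=
    { symm_stack := fun h => ⟨h.1.symm, Sym2.eq_swap ▸ h.2⟩
      symm_queue := fun h => ⟨h.1.symm, Sym2.eq_swap ▸ h.2⟩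
      noCross := fun h₁ h₂ => L.noCross _ _ _ _ h₁.1 h₂.1 h₁.2 h₂.2
      noNest := fun h₁ h₂ => L.noNest _ _ _ _ h₁.1 h₂.1 h₁.2 h₂.2
      attach := fun {a b} hab => by
        refine (hG a b (hab.elim And.left And.left)).mono fun x hx => ?_
        have := hx.1
        have := hx.2
        simp only [Set.mem_ofPred_eq]
        tauto }
  rcases lt_or_gt_of_ne huv.ne with hlt | hlt
  · exact h.false_of_edge hlt (by tauto)
  · have := huv.symm
    exact h.false_of_edge hlt (by tauto)

/-- Compactness: a graph on `ℕ` has a mixed layout as soon as all its restrictions to initial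
segments do. -/
lemma nonempty_of_forall_initial {G : SimpleGraph ℕ}
    (h : ∀ n, Nonempty (MixedLayout (G.comap (Fin.val : Fin (n + 2) → ℕ)))) :
    Nonempty (MixedLayout G) := by
  have L := fun n => (h n).some
  let c : (n : ℕ) → ℕ → Fin (n + 2) := fun n a => Fin.ofNat (n + 2) a
  have hc (a : ℕ) : ∀ᶠ n in Filter.hyperfilter ℕ, (c n a : ℕ) = a := by
    refine Filter.Eventually.filter_mono Nat.hyperfilter_le_atTop ?_
    filter_upwards [Filter.eventually_ge_atTop a] with n hn
    exact Nat.mod_eq_of_lt (by omega)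
  refine ⟨⟨fun a b => ∀ᶠ n in Filter.hyperfilter ℕ, (L n).lt (c n a) (c n b), ?_,
    fun e => ∀ᶠ n in Filter.hyperfilter ℕ, (L n).isStack (e.map (c n)), ?_, ?_⟩⟩
  · refine { trichotomous := ?_, irrefl := ?_, trans := ?_ }
    · intro a b hab hba
      rw [← Ultrafilter.eventually_not] at hab hba
      obtain ⟨n, h₁, h₂, h₃, h₄⟩ := (hab.and (hba.and ((hc a).and (hc b)))).exists
      have := (L n).isSTO
      rw [← h₃, ← h₄, Std.Trichotomous.trichotomous (r := (L n).lt) _ _ h₁ h₂]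
    · intro a ha
      obtain ⟨n, hn⟩ := ha.exists
      have := (L n).isSTO
      exact irrefl_of (L n).lt _ hn
    · intro a b d hab hbd
      filter_upwards [hab, hbd] with n h₁ h₂
      have := (L n).isSTO
      exact trans_of (L n).lt h₁ h₂
  · rintro a b d e hab hde sab sde ⟨h₁, h₂, h₃⟩
    obtain ⟨n, ha, hb, hd, he, sab, sde, h₁, h₂, h₃⟩ := ((hc a).and <| (hc b).and <| (hc d).and <|
      (hc e).and <| sab.and <| sde.and <| h₁.and <| h₂.and h₃).exists
    exact (L n).noCross _ _ _ _ (by simpa [ha, hb]) (by simpa [hd, he]) sab sde ⟨h₁, h₂, h₃⟩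
  · rintro a b d e hab hde qab qde ⟨h₁, h₂, h₃⟩
    rw [← Ultrafilter.eventually_not] at qab qde
    obtain ⟨n, ha, hb, hd, he, qab, qde, h₁, h₂, h₃⟩ := ((hc a).and <| (hc b).and <| (hc d).and <|
      (hc e).and <| qab.and <| qde.and <| h₁.and <| h₂.and h₃).exists
    exact (L n).noNest _ _ _ _ (by simpa [ha, hb]) (by simpa [hd, he]) qab qde ⟨h₁, h₂, h₃⟩

end MixedLayout

/-- An enumeration of the edges of an infinite 2-tree on `ℕ`, larger endpoint first: vertex `i ≥ 2`
is attached to the edge number `(Nat.unpair i).1`, which creates the edges number `2 * i` and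
`2 * i + 1`. -/
def attachEdge (j : ℕ) : ℕ × ℕ :=
  if _ : j < 4 then (1, 0)
  else
    let p := attachEdge (Nat.unpair (j / 2)).1
    (j / 2, if j % 2 = 0 then p.1 else p.2)
termination_by j
decreasing_by
  have := Nat.unpair_left_le (j / 2)
  omega

lemma attachEdge_of_lt {j : ℕ} (hj : j < 4) : attachEdge j = (1, 0) := by
  rw [attachEdge, dif_pos hj]

lemma attachEdge_two_mul {i : ℕ} (hi : 2 ≤ i) :
    attachEdge (2 * i) = (i, (attachEdge (Nat.unpair i).1).1) := by
  rw [attachEdge, dif_neg (by omega)]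
  simp

lemma attachEdge_two_mul_add_one {i : ℕ} (hi : 2 ≤ i) :
    attachEdge (2 * i + 1) = (i, (attachEdge (Nat.unpair i).1).2) := by
  have : (2 * i + 1) / 2 = i := by omega
  rw [attachEdge, dif_neg (by omega)]
  simp [this, Nat.add_mod]

lemma attachEdge_cases (j : ℕ) : attachEdge j = (1, 0) ∨
    ∃ i, 2 ≤ i ∧ i ≤ j ∧ (attachEdge j = (i, (attachEdge (Nat.unpair i).1).1) ∨
      attachEdge j = (i, (attachEdge (Nat.unpair i).1).2)) := by
  rcases lt_or_ge j 4 with hj | hj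
  · exact .inl (attachEdge_of_lt hj)
  · refine .inr ⟨j / 2, by omega, by omega, ?_⟩
    rcases Nat.even_or_odd' j with ⟨i, rfl | rfl⟩
    · rw [attachEdge_two_mul (by omega)]
      simp
    · have : (2 * i + 1) / 2 = i := by omega
      rw [attachEdge_two_mul_add_one (by omega)]
      simp [this]

lemma attachEdge_fst_le (j : ℕ) : (attachEdge j).1 ≤ max 1 (j / 2) := by
  rw [attachEdge]
  split <;> simp

lemma attachEdge_unpair_fst_lt {i : ℕ} (hi : 2 ≤ i) : (attachEdge (Nat.unpair i).1).1 < i := by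
  have := attachEdge_fst_le (Nat.unpair i).1
  have := Nat.unpair_left_le i
  omega

lemma attachEdge_snd_lt_fst (j : ℕ) : (attachEdge j).2 < (attachEdge j).1 := by
  induction j using Nat.strong_induction_on with
  | _ j ih =>
    rw [attachEdge]
    split
    · simp
    · have h₁ := ih (Nat.unpair (j / 2)).1 (by have := Nat.unpair_left_le (j / 2); omega)
      have h₂ := attachEdge_unpair_fst_lt (i := j / 2) (by omega)
      dsimp only
      split <;> omega

/-- The infinite 2-tree on `ℕ` with edges enumerated by `attachEdge`. -/
def attachGraph : SimpleGraph ℕ where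
  Adj a b := ∃ j, attachEdge j = (a, b) ∨ attachEdge j = (b, a)
  symm := ⟨fun _ _ ⟨j, hj⟩ => ⟨j, hj.symm⟩⟩
  loopless := ⟨fun a ⟨j, hj⟩ => by
    have := attachEdge_snd_lt_fst j
    simp_all⟩

lemma attachGraph_infinite_common_neighbors (u v : ℕ) (huv : attachGraph.Adj u v) :
    {x | attachGraph.Adj u x ∧ attachGraph.Adj v x}.Infinite := by
  obtain ⟨j, hj⟩ := huv
  refine Set.infinite_of_injective_forall_mem (f := fun k => Nat.pair j (k + 2))
    (fun k l hkl => by simpa using hkl) fun k => ?_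
  have h2 : 2 ≤ Nat.pair j (k + 2) := by
    have := Nat.right_le_pair j (k + 2)
    omega
  have h₁ := attachEdge_two_mul h2
  have h₂ := attachEdge_two_mul_add_one h2
  rw [Nat.unpair_pair] at h₁ h₂
  rcases hj with hj | hj <;> rw [hj] at h₁ h₂
  · exact ⟨⟨_, .inr h₁⟩, ⟨_, .inr h₂⟩⟩
  · exact ⟨⟨_, .inr h₂⟩, ⟨_, .inr h₁⟩⟩

lemma exists_attachEdge_eq_iff {a b : ℕ} : (∃ j, attachEdge j = (a, b)) ↔
    (a = 1 ∧ b = 0) ∨ (2 ≤ a ∧ (b = (attachEdge (Nat.unpair a).1).1 ∨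
      b = (attachEdge (Nat.unpair a).1).2)) := by
  constructor
  · rintro ⟨j, hj⟩
    rcases attachEdge_cases j with h | ⟨i, hi, -, h | h⟩ <;> rw [hj, Prod.mk.injEq] at h
    · exact .inl h
    · obtain ⟨rfl, rfl⟩ := h
      exact .inr ⟨hi, .inl rfl⟩
    · obtain ⟨rfl, rfl⟩ := h
      exact .inr ⟨hi, .inr rfl⟩
  · rintro (⟨rfl, rfl⟩ | ⟨ha, rfl | rfl⟩)
    · exact ⟨0, attachEdge_of_lt (by omega)⟩
    · exact ⟨_, attachEdge_two_mul ha⟩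
    · exact ⟨_, attachEdge_two_mul_add_one ha⟩

lemma isTwoTree_comap_attachGraph (n : ℕ) :
    IsTwoTree (attachGraph.comap (Fin.val : Fin (n + 2) → ℕ)) := by
  have hlt (i : Fin (n + 2)) : (attachEdge (Nat.unpair i).1).1 < n + 2 := by
    have := attachEdge_fst_le (Nat.unpair i).1
    have := Nat.unpair_left_le i
    omega
  refine ⟨by omega, fun i => ⟨_, hlt i⟩,
    fun i => ⟨_, (attachEdge_snd_lt_fst (Nat.unpair i).1).trans (hlt i)⟩, fun i hi => ?_,
    fun a b => ?_⟩
  · have := attachEdge_unpair_fst_lt hi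
    exact ⟨this, (attachEdge_snd_lt_fst _).trans this, ⟨_, .inl rfl⟩⟩
  · have : attachGraph.Adj a b ↔ _ := exists_or
    rw [SimpleGraph.comap_adj, this, exists_attachEdge_eq_iff, exists_attachEdge_eq_iff]
    simp only [Fin.ext_iff]
    tauto

/-- There exists a 2-tree that does not admit a mixed 1-stack 1-queue layout. -/
theorem exists_two_tree_no_mixed_layout :
    ∃ (n : ℕ) (G : SimpleGraph (Fin n)), IsTwoTree G ∧ IsEmpty (MixedLayout G) := by
  by_contra! h
  have hadj : attachGraph.Adj 1 0 := ⟨0, .inl (attachEdge_of_lt (by omega))⟩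
  have hempty := MixedLayout.isEmpty_of_infinite_common_neighbors hadj
    attachGraph_infinite_common_neighbors
  have := MixedLayout.nonempty_of_forall_initial fun n => h _ _ (isTwoTree_comap_attachGraph n)
  exact not_isEmpty_iff.2 this hempty
end

section
/- Let L be a mixed 1-stack 1-queue layout of G(k,ℓ) with k > 1 and ℓ > 2. Then every edge of the subgraph G(k-1,ℓ) has at most two stack-attachments among the ℓ vertices of Ḡ(k,ℓ) attached to it in L. -/
/-- Two stack-attachments of an edge `{u,v}` with `u ≺ v`, the first preceding the second,
cannot lie on the same side of the edge: exactly one of them is between `u` and `v`. -/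
theorem MixedLayout.not_between_iff_of_lt {V : Type} {G : SimpleGraph V} (L : MixedLayout G)
    {u v x y : V} (huv : L.lt u v) (hx : StackAtt L x u v) (hy : StackAtt L y u v)
    (hxy : L.lt x y) : ¬((L.lt u x ∧ L.lt x v) ↔ (L.lt u y ∧ L.lt y v)) := by
  have := L.isSTO
  obtain ⟨⟨axu, sxu⟩, axv, sxv⟩ := hx
  obtain ⟨⟨ayu, syu⟩, ayv, syv⟩ := hy
  have sux := Sym2.eq_swap ▸ sxu
  have suy := Sym2.eq_swap ▸ syu
  have svy := Sym2.eq_swap ▸ syv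
  have inside := L.noCross u y x v ayu.symm axv suy sxv
  have left := L.noCross x u y v axu ayv sxu syv
  have around := L.noCross x v u y axv ayu.symm sxv suy
  have right := L.noCross u x v y axu.symm ayv.symm sux svy
  have total : ∀ {a b : V}, a ≠ b → L.lt a b ∨ L.lt b a := fun h =>
    (trichotomous_of L.lt _ _).imp_right fun h' => h'.resolve_left h
  intro hiff
  rcases total axu.ne with hxu | hux
  · rcases total ayu.ne with hyu | huy
    · exact left ⟨hxy, hyu, huv⟩
    · rcases total ayv.ne with hyv | hvy
      · exact asymm_of L.lt hxu (hiff.mpr ⟨huy, hyv⟩).1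
      · exact around ⟨hxu, huv, hvy⟩
  · rcases total axv.ne with hxv | hvx
    · exact inside ⟨hux, hxy, (hiff.mp ⟨hux, hxv⟩).2⟩
    · exact right ⟨huv, hvx, hxy⟩

/-- No edge has three distinct stack-attachments: `K_{2,3}` has no one-stack layout. -/
theorem MixedLayout.ncard_stackAtt_le_two {V : Type} {G : SimpleGraph V} (L : MixedLayout G)
    {u v : V} (huv : u ≠ v) {s : Set V} (hs : ∀ x ∈ s, StackAtt L x u v) : s.ncard ≤ 2 := by
  have := L.isSTO
  wlog h : L.lt u v generalizing u v
  · exact this huv.symm (fun x hx => (hs x hx).symm)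
      (((trichotomous_of L.lt u v).resolve_left h).resolve_left huv)
  have key : ∀ x ∈ s, ∀ y ∈ s, x ≠ y →
      ¬((L.lt u x ∧ L.lt x v) ↔ (L.lt u y ∧ L.lt y v)) := fun x hx y hy hxy hiff => by
    rcases trichotomous_of L.lt x y with hlt | heq | hgt
    · exact L.not_between_iff_of_lt h (hs x hx) (hs y hy) hlt hiff
    · exact hxy heq
    · exact L.not_between_iff_of_lt h (hs y hy) (hs x hx) hgt hiff.symm
  by_contra! hcard
  obtain ⟨x, y, z, hx, hy, hz, hxy, hxz, hyz⟩ :=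
    (Set.two_lt_ncard_iff (Set.finite_of_ncard_pos (by omega))).mp hcard
  have h₁ := key x hx y hy hxy
  have h₂ := key x hx z hz hxz
  have h₃ := key y hy z hz hyz
  tauto

/-- Every edge of `G(k-1,ℓ)` has at most two stack-attachments among the vertices
of `Ḡ(k,ℓ)` attached to it. -/
theorem at_most_two_stack_attachments (k ℓ : ℕ) (hk : 1 < k) (hl : 2 < ℓ)
    (L : MixedLayout (Gkl k ℓ)) (u v : PV ℓ) (huv : (Gkl (k - 1) ℓ).Adj u v) :
    {x : PV ℓ | AttachedAt ℓ k x u v ∧ StackAtt L x u v}.ncard ≤ 2 :=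
  L.ncard_stackAtt_le_two huv.ne fun _ hx => hx.2
end

section
/- Let L be a mixed 1-stack 1-queue layout of G(k,ℓ) with k > 1 and ℓ > 2. Then no smiley face is formed by the vertices and edges of the subgraph G(k-1,ℓ) in L. -/
theorem Gkl_adj_iff {k ℓ : ℕ} {x y : PV ℓ} :
    (Gkl k ℓ).Adj x y ↔ ((x, y) ∈ Gedges ℓ k ∨ (y, x) ∈ Gedges ℓ k) ∧ x ≠ y := by
  simp only [Gkl, SimpleGraph.fromEdgeSet_adj, Set.mem_image, Prod.exists, Sym2.eq_iff]
  refine and_congr_left fun _ => ⟨?_, ?_⟩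
  · rintro ⟨p, q, h, ⟨rfl, rfl⟩ | ⟨rfl, rfl⟩⟩
    · exact Or.inl h
    · exact Or.inr h
  · rintro (h | h)
    · exact ⟨x, y, h, Or.inl ⟨rfl, rfl⟩⟩
    · exact ⟨y, x, h, Or.inr ⟨rfl, rfl⟩⟩

theorem Gkl_le_succ (m ℓ : ℕ) : Gkl (m + 1) ℓ ≤ Gkl (m + 2) ℓ := by
  intro x y h
  rw [Gkl_adj_iff] at h ⊢
  exact ⟨h.1.imp Or.inl Or.inl, h.2⟩

/-- A vertex attached in a later step is not an endpoint of an edge of `G(m,ℓ)`. -/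
theorem ne_att_of_mem_Gedges {ℓ m j : ℕ} (hj : m < j) {p q u v : PV ℓ} {i : Fin ℓ}
    (h : (p, q) ∈ Gedges ℓ m) : p ≠ PV.att j u v i ∧ q ≠ PV.att j u v i := by
  induction m generalizing p q with
  | zero => exact h.elim
  | succ m ih =>
    cases m with
    | zero =>
      obtain ⟨rfl, rfl⟩ := Prod.mk.inj h
      exact ⟨nofun, nofun⟩
    | succ m =>
      have ih' := fun {p q} => @ih (by omega) p q
      rcases h with h | ⟨u', v', i', h, h' | h'⟩
      · exact ih' h
      all_goals
        obtain ⟨rfl, rfl⟩ := Prod.mk.inj h'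
        refine ⟨fun e => ?_, ?_⟩
        · have := (PV.att.inj e).1
          omega
      · exact (ih' h).1
      · exact (ih' h).2

theorem ne_att_of_Gkl_adj {ℓ m j : ℕ} (hj : m < j) {x y u v : PV ℓ} {i : Fin ℓ}
    (h : (Gkl m ℓ).Adj x y) : x ≠ PV.att j u v i :=
  (Gkl_adj_iff.1 h).1.elim (fun h => (ne_att_of_mem_Gedges hj h).1)
    fun h => (ne_att_of_mem_Gedges hj h).2

/-- Every edge of `G(m+1,ℓ)` has `ℓ` vertices of `G(m+2,ℓ)` attached to it. -/
theorem exists_attached {ℓ m : ℕ} {u v : PV ℓ} (h : (Gkl (m + 1) ℓ).Adj u v) :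
    ∃ f : Fin ℓ → PV ℓ, Function.Injective f ∧
      ∀ i, (Gkl (m + 2) ℓ).Adj (f i) u ∧ (Gkl (m + 2) ℓ).Adj (f i) v ∧
        ∀ x y, (Gkl (m + 1) ℓ).Adj x y → x ≠ f i := by
  rcases (Gkl_adj_iff.1 h).1 with huv | huv
  · refine ⟨PV.att (m + 2) u v, fun i j e => (PV.att.inj e).2.2.2, fun i => ⟨?_, ?_, ?_⟩⟩
    · exact Gkl_adj_iff.2 ⟨Or.inl (Or.inr ⟨u, v, i, huv, Or.inl rfl⟩),
        (ne_att_of_Gkl_adj (by omega) h).symm⟩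
    · exact Gkl_adj_iff.2 ⟨Or.inl (Or.inr ⟨u, v, i, huv, Or.inr rfl⟩),
        (ne_att_of_Gkl_adj (by omega) h.symm).symm⟩
    · exact fun x y hxy => ne_att_of_Gkl_adj (by omega) hxy
  · refine ⟨PV.att (m + 2) v u, fun i j e => (PV.att.inj e).2.2.2, fun i => ⟨?_, ?_, ?_⟩⟩
    · exact Gkl_adj_iff.2 ⟨Or.inl (Or.inr ⟨v, u, i, huv, Or.inr rfl⟩),
        (ne_att_of_Gkl_adj (by omega) h).symm⟩
    · exact Gkl_adj_iff.2 ⟨Or.inl (Or.inr ⟨v, u, i, huv, Or.inl rfl⟩),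
        (ne_att_of_Gkl_adj (by omega) h.symm).symm⟩
    · exact fun x y hxy => ne_att_of_Gkl_adj (by omega) hxy

namespace MixedLayout

variable {V : Type} {G : SimpleGraph V} (L : MixedLayout G)

theorem lt_trans {a b c : V} (h : L.lt a b) (h' : L.lt b c) : L.lt a c :=
  have := L.isSTO
  _root_.trans h h'

theorem lt_or_gt_of_ne {a b : V} (h : a ≠ b) : L.lt a b ∨ L.lt b a := by
  have := L.isSTO
  rcases trichotomous_of L.lt a b with h' | h' | h'
  exacts [Or.inl h', (h h').elim, Or.inr h']

/-- If `a ≺ b ≺ w ≺ c ≺ d` and `{a,b}`, `{c,d}`, `{a,d}` are queue-edges, then every edge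
from `w` to a vertex other than `a` and `d` is a stack-edge. -/
theorem isStack_of_between {a b c d w x : V} (hab : L.lt a b) (hbw : L.lt b w)
    (hwc : L.lt w c) (hcd : L.lt c d) (qab : QEdgeIn L G a b) (qcd : QEdgeIn L G c d)
    (qad : QEdgeIn L G a d) (hxw : G.Adj x w) (hxa : a ≠ x) (hxd : d ≠ x) :
    L.isStack s(x, w) := by
  by_contra hs
  have hs' : ¬L.isStack s(w, x) := by rwa [Sym2.eq_swap]
  rcases L.lt_or_gt_of_ne hxa with hax | hxa
  · rcases L.lt_or_gt_of_ne hxd with hdx | hxd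
    · exact L.noNest _ _ _ _ hxw.symm qcd.1 hs' qcd.2 ⟨hwc, hcd, hdx⟩
    · rcases L.lt_or_gt_of_ne hxw.ne with h | h
      · exact L.noNest _ _ _ _ qad.1 hxw qad.2 hs ⟨hax, h, L.lt_trans hwc hcd⟩
      · exact L.noNest _ _ _ _ qad.1 hxw.symm qad.2 hs' ⟨L.lt_trans hab hbw, h, hxd⟩
  · exact L.noNest _ _ _ _ hxw qab.1 hs qab.2 ⟨hxa, hab, hbw⟩

/-- Two distinct stack-attachments of an edge `{u,v}` are separated by `u` or `v`. -/
theorem StackAtt.separated {L : MixedLayout G} {u v x y : V} (huv : L.lt u v) (hxy : x ≠ y)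
    (hx : StackAtt L x u v) (hy : StackAtt L y u v) :
    ¬(L.lt x u ∧ L.lt y u) ∧ ¬(L.lt v x ∧ L.lt v y) ∧
      ¬((L.lt u x ∧ L.lt x v) ∧ L.lt u y ∧ L.lt y v) := by
  wlog h : L.lt x y generalizing x y
  · have := this hxy.symm hy hx ((L.lt_or_gt_of_ne hxy).resolve_left h)
    tauto
  obtain ⟨⟨xu, sxu⟩, ⟨xv, sxv⟩⟩ := hx
  obtain ⟨⟨yu, syu⟩, ⟨yv, syv⟩⟩ := hy
  refine ⟨fun k => ?_, fun k => ?_, fun k => ?_⟩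
  · exact L.noCross _ _ _ _ xu yv sxu syv ⟨h, k.2, huv⟩
  · exact L.noCross _ _ _ _ xu.symm yv.symm (Sym2.eq_swap ▸ sxu) (Sym2.eq_swap ▸ syv)
      ⟨huv, k.1, h⟩
  · exact L.noCross _ _ _ _ yu.symm xv (Sym2.eq_swap ▸ syu) sxv ⟨k.1.1, h, k.2.2⟩

/-- Stack-attachments of `{u,v}` do not lie on both outer sides of the edge. -/
theorem StackAtt.not_both_sides {L : MixedLayout G} {u v x y : V} (huv : L.lt u v)
    (hx : StackAtt L x u v) (hy : StackAtt L y u v) : ¬(L.lt x u ∧ L.lt v y) :=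
  fun k => L.noCross _ _ _ _ hx.2.1 hy.1.1.symm hx.2.2 (Sym2.eq_swap ▸ hy.1.2)
    ⟨k.1, huv, k.2⟩

theorem StackAtt.position {L : MixedLayout G} {u v x : V} (hx : StackAtt L x u v) :
    L.lt x u ∨ L.lt v x ∨ (L.lt u x ∧ L.lt x v) := by
  have := L.lt_or_gt_of_ne hx.1.1.ne
  have := L.lt_or_gt_of_ne hx.2.1.ne
  tauto

/-- No edge has three distinct stack-attachments. -/
theorem not_three_stackAtt {u v x y z : V} (huv : L.lt u v) (hxy : x ≠ y) (hxz : x ≠ z)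
    (hyz : y ≠ z) (hx : StackAtt L x u v) (hy : StackAtt L y u v) : ¬StackAtt L z u v := by
  intro hz
  have := StackAtt.separated huv hxy hx hy
  have := StackAtt.separated huv hxz hx hz
  have := StackAtt.separated huv hyz hy hz
  have := StackAtt.not_both_sides huv hx hy
  have := StackAtt.not_both_sides huv hx hz
  have := StackAtt.not_both_sides huv hy hx
  have := StackAtt.not_both_sides huv hy hz
  have := StackAtt.not_both_sides huv hz hx
  have := StackAtt.not_both_sides huv hz hy
  have := StackAtt.position hx
  have := StackAtt.position hy
  have := StackAtt.position hz
  grind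

end MixedLayout

/-- No smiley face is formed by the vertices and edges of the subgraph `G(k-1,ℓ)`
in a mixed 1-stack 1-queue layout of `G(k,ℓ)` with `k > 1`, `ℓ > 2`. -/
theorem no_smiley_face (k ℓ : ℕ) (hk : 1 < k) (hl : 2 < ℓ)
    (L : MixedLayout (Gkl k ℓ)) :
    ¬∃ a b u v c d : PV ℓ, Smiley L (Gkl (k - 1) ℓ) a b u v c d := by
  obtain ⟨m, rfl⟩ := Nat.exists_eq_add_of_le' hk
  rintro ⟨a, b, u, v, c, d, hab, hbu, huv, hvc, hcd, qab, qcd, qad, suv⟩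
  have hle := Gkl_le_succ m ℓ
  obtain ⟨f, hf, hadj⟩ := exists_attached suv.1
  have hatt : ∀ i, StackAtt L (f i) u v := fun i => by
    obtain ⟨hu, hv, hne⟩ := hadj i
    have key := fun w hbw hwc hw => L.isStack_of_between (w := w) hab hbw hwc hcd
      ⟨hle qab.1, qab.2⟩ ⟨hle qcd.1, qcd.2⟩ ⟨hle qad.1, qad.2⟩ hw
      (hne _ _ qad.1) (hne _ _ qad.1.symm)
    exact ⟨⟨hu, key u hbu (L.lt_trans huv hvc) hu⟩, ⟨hv, key v (L.lt_trans hbu huv) hvc hv⟩⟩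
  exact L.not_three_stackAtt huv (hf.ne (a₁ := ⟨0, by omega⟩) (a₂ := ⟨1, by omega⟩) (by simp))
    (hf.ne (a₂ := ⟨2, hl⟩) (by simp)) (hf.ne (by simp)) (hatt _) (hatt _) (hatt _)
end

section
/- Let L be a mixed 1-stack 1-queue layout of G(k,ℓ) with k > 1, and suppose a smiley face ⟨a,b,u,v,c,d⟩ is formed by vertices and edges of the subgraph G(k-1,ℓ) in L. Then every vertex x of Ḡ(k,ℓ) attached to the edge {u,v} is a stack-attachment of {u,v}, i.e., both {x,u} and {x,v} are stack-edges. -/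
theorem Gedges_mono (ℓ k : ℕ) : Gedges ℓ (k - 1) ⊆ Gedges ℓ k := by
  rcases k with _ | _ | k
  · exact subset_rfl
  · exact Set.empty_subset _
  · exact Set.subset_union_left

/-- Vertices attached at step `j` do not occur in `G(k,ℓ)` for `k < j`. -/
theorem le_of_att_mem_Gedges {ℓ : ℕ} {j : ℕ} {u v : PV ℓ} {i : Fin ℓ} :
    ∀ {k : ℕ} {p : PV ℓ × PV ℓ}, p ∈ Gedges ℓ k →
      (p.1 = PV.att j u v i ∨ p.2 = PV.att j u v i) → j ≤ k
  | 0, _, hp, _ => hp.elim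
  | 1, _, hp, h => by
    obtain rfl : _ = (PV.A, PV.B) := hp
    simp at h
  | k + 2, p, hp, h => by
    rcases hp with hp | ⟨u', v', i', huv, rfl | rfl⟩
    · exact (le_of_att_mem_Gedges hp h).trans (Nat.le_succ _)
    · rcases h with h | h
      · cases h
        exact le_rfl
      · exact (le_of_att_mem_Gedges huv (Or.inl h)).trans (Nat.le_succ _)
    · rcases h with h | h
      · cases h
        exact le_rfl
      · exact (le_of_att_mem_Gedges huv (Or.inr h)).trans (Nat.le_succ _)

theorem Gbar_adj_iff {k ℓ : ℕ} {x y : PV ℓ} :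
    (Gbar k ℓ).Adj x y ↔ ((x, y) ∈ Gedges ℓ k \ Gedges ℓ (k - 1) ∨
      (y, x) ∈ Gedges ℓ k \ Gedges ℓ (k - 1)) ∧ x ≠ y := by
  simp only [Gbar, SimpleGraph.fromEdgeSet_adj, Set.mem_image, Prod.exists, Sym2.eq_iff]
  grind

theorem Gkl_pred_le (k ℓ : ℕ) : Gkl (k - 1) ℓ ≤ Gkl k ℓ := fun _ _ h => by
  rw [Gkl_adj_iff] at h ⊢
  exact h.imp_left (Or.imp (@Gedges_mono ℓ k _) (@Gedges_mono ℓ k _))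

theorem Gbar_le (k ℓ : ℕ) : Gbar k ℓ ≤ Gkl k ℓ := fun _ _ h => by
  rw [Gbar_adj_iff] at h
  exact Gkl_adj_iff.2 (h.imp_left (Or.imp And.left And.left))

theorem not_Gkl_adj_att {k ℓ : ℕ} {u v y : PV ℓ} {i : Fin ℓ} (hk : 1 < k) :
    ¬ (Gkl (k - 1) ℓ).Adj (PV.att k u v i) y := fun h => by
  have hle : k ≤ k - 1 := (Gkl_adj_iff.1 h).1.elim
    (fun h => le_of_att_mem_Gedges h (Or.inl rfl)) (fun h => le_of_att_mem_Gedges h (Or.inr rfl))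
  omega

theorem exists_eq_att_of_mem_diff {k ℓ : ℕ} (hk : 1 < k) {x y : PV ℓ}
    (h : (x, y) ∈ Gedges ℓ k \ Gedges ℓ (k - 1)) : ∃ u v i, x = PV.att k u v i := by
  obtain ⟨k, rfl⟩ := Nat.exists_eq_add_of_le' hk
  obtain ⟨h | ⟨u, v, i, -, h | h⟩, hn⟩ := h
  · exact absurd h hn
  · exact ⟨u, v, i, congrArg Prod.fst h⟩
  · exact ⟨u, v, i, congrArg Prod.fst h⟩

/-- A `Ḡ(k,ℓ)`-neighbour of a vertex of `G(k-1,ℓ)` is not itself a vertex of `G(k-1,ℓ)`. -/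
theorem not_Gkl_adj_of_Gbar_adj {k ℓ : ℕ} (hk : 1 < k) {x w w' y : PV ℓ}
    (hx : (Gbar k ℓ).Adj x w) (hw : (Gkl (k - 1) ℓ).Adj w w') : ¬ (Gkl (k - 1) ℓ).Adj x y := by
  rcases (Gbar_adj_iff.1 hx).1 with h | h
  · obtain ⟨_, _, _, rfl⟩ := exists_eq_att_of_mem_diff hk h
    exact not_Gkl_adj_att hk
  · obtain ⟨_, _, _, rfl⟩ := exists_eq_att_of_mem_diff hk h
    exact absurd hw (not_Gkl_adj_att hk)

/-- Below the queue-edges `{a,b}`, `{c,d}`, `{a,d}`, an edge from a vertex strictly between `b`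
and `c` to a vertex other than `a` and `d` is a stack-edge. -/
theorem MixedLayout.isStack_of_between_s4 {V : Type} {G : SimpleGraph V} (L : MixedLayout G)
    {a b c d w x : V} (hab : L.lt a b) (hbw : L.lt b w) (hwc : L.lt w c) (hcd : L.lt c d)
    (qab : QEdgeIn L G a b) (qcd : QEdgeIn L G c d) (qad : QEdgeIn L G a d)
    (hxw : G.Adj x w) (hxa : x ≠ a) (hxd : x ≠ d) : L.isStack s(x, w) := by
  by_contra hq
  have hq' : ¬ L.isStack s(w, x) := by rwa [Sym2.eq_swap]
  have := L.isSTO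
  have tri := trichotomous_of L.lt
  have htr : ∀ {p q r}, L.lt p q → L.lt q r → L.lt p r := trans_of L.lt
  rcases tri x a with h | h | hax
  · exact L.noNest x w a b hxw qab.1 hq qab.2 ⟨h, hab, hbw⟩
  · exact hxa h
  rcases tri x d with hdx | h | h
  · rcases tri x w with h | h | h
    · exact L.noNest a d x w qad.1 hxw qad.2 hq ⟨hax, h, htr hwc hcd⟩
    · exact hxw.ne h
    · exact L.noNest a d w x qad.1 hxw.symm qad.2 hq' ⟨htr hab hbw, h, hdx⟩
  · exact hxd h
  · exact L.noNest w x c d hxw.symm qcd.1 hq' qcd.2 ⟨hwc, hcd, h⟩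

/-- If a smiley face `⟨a,b,u,v,c,d⟩` is formed by vertices and edges of `G(k-1,ℓ)`
in a mixed layout of `G(k,ℓ)` with `k > 1`, then every vertex `x` of `Ḡ(k,ℓ)`
attached to the edge `{u,v}` is a stack-attachment of `{u,v}`. -/
theorem smiley_forces_stack_attachments (k ℓ : ℕ) (hk : 1 < k)
    (L : MixedLayout (Gkl k ℓ)) (a b u v c d : PV ℓ)
    (hs : Smiley L (Gkl (k - 1) ℓ) a b u v c d) :
    ∀ x : PV ℓ, AttachedAt ℓ k x u v → StackAtt L x u v := by
  rintro x ⟨hxu, hxv⟩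
  obtain ⟨hab, hbu, huv, hvc, hcd, qab, qcd, qad, suv⟩ := hs
  have := L.isSTO
  have hx : ∀ y, ¬ (Gkl (k - 1) ℓ).Adj x y := fun _ => not_Gkl_adj_of_Gbar_adj hk hxu suv.1
  have hxa : x ≠ a := by
    rintro rfl
    exact hx _ qab.1
  have hxd : x ≠ d := by
    rintro rfl
    exact hx _ qcd.1.symm
  have lift : ∀ {p q}, QEdgeIn L (Gkl (k - 1) ℓ) p q → QEdgeIn L (Gkl k ℓ) p q :=
    And.imp_left (@Gkl_pred_le k ℓ _ _)
  have huc : L.lt u c := trans_of L.lt huv hvc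
  have hbv : L.lt b v := trans_of L.lt hbu huv
  have key : ∀ {w}, (Gbar k ℓ).Adj x w → L.lt b w → L.lt w c → SEdgeIn L (Gkl k ℓ) x w :=
    fun hxw hbw hwc => ⟨Gbar_le k ℓ hxw, L.isStack_of_between_s4 hab hbw hwc hcd
      (lift qab) (lift qcd) (lift qad) (Gbar_le k ℓ hxw) hxa hxd⟩
  exact ⟨key hxu hbu huc, key hxv hbv hvc⟩
end

section
/- Let L be a mixed 1-stack 1-queue layout of G(k,ℓ) with k > 1 and ℓ > 2, and let a, b, c be three distinct queue-attachments in Ḡ(k,ℓ) of an edge {u,v} of G(k-1,ℓ) with u ≺ v. Then u ≺ a ≺ v, u ≺ b ≺ v and u ≺ c ≺ v. -/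
section QueueAttachments

variable {V : Type} {G : SimpleGraph V} {L : MixedLayout G} {u v x y z : V}

theorem QEdgeIn.symm {H : SimpleGraph V} (h : QEdgeIn L H x y) : QEdgeIn L H y x :=
  ⟨h.1.symm, Sym2.eq_swap (a := x) (b := y) ▸ h.2⟩

theorem QEdgeIn.not_nest {w : V} (h : QEdgeIn L G x y) (h' : QEdgeIn L G z w)
    (hxz : L.lt x z) (hzw : L.lt z w) : ¬L.lt w y :=
  fun hwy => L.noNest x y z w h.1 h'.1 h.2 h'.2 ⟨hxz, hzw, hwy⟩

theorem MixedLayout.lt_trichotomy (L : MixedLayout G) (x y : V) :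
    L.lt x y ∨ x = y ∨ L.lt y x :=
  haveI := L.isSTO
  trichotomous_of L.lt x y

/-- Two distinct queue-attachments of the same edge do not both precede it. -/
theorem QueueAtt.not_both_left (huv : L.lt u v) (hxy : x ≠ y)
    (hx : QueueAtt L x u v) (hy : QueueAtt L y u v) : ¬(L.lt x u ∧ L.lt y u) := by
  rintro ⟨hxu, hyu⟩
  rcases L.lt_trichotomy x y with h | h | h
  · exact hx.2.not_nest hy.1 h hyu huv
  · exact hxy h
  · exact hy.2.not_nest hx.1 h hxu huv

/-- Two distinct queue-attachments of the same edge do not both succeed it. -/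
theorem QueueAtt.not_both_right (huv : L.lt u v) (hxy : x ≠ y)
    (hx : QueueAtt L x u v) (hy : QueueAtt L y u v) : ¬(L.lt v x ∧ L.lt v y) := by
  rintro ⟨hvx, hvy⟩
  rcases L.lt_trichotomy x y with h | h | h
  · exact hy.1.symm.not_nest hx.2.symm huv hvx h
  · exact hxy h
  · exact hx.1.symm.not_nest hy.2.symm huv hvy h

/-- A queue-attachment of an edge lies to its left, between its ends, or to its right. -/
theorem QueueAtt.left_or_middle_or_right (hx : QueueAtt L x u v) :
    L.lt x u ∨ (L.lt u x ∧ L.lt x v) ∨ L.lt v x := by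
  rcases L.lt_trichotomy x u with h | h | h
  · exact Or.inl h
  · exact absurd h hx.1.1.ne
  · rcases L.lt_trichotomy x v with h' | h' | h'
    · exact Or.inr (Or.inl ⟨h, h'⟩)
    · exact absurd h' hx.2.1.ne
    · exact Or.inr (Or.inr h')

/-- A queue-attachment of an edge with two further queue-attachments lies between its ends. -/
theorem QueueAtt.middle (huv : L.lt u v) (hxy : x ≠ y) (hxz : x ≠ z) (hyz : y ≠ z)
    (hx : QueueAtt L x u v) (hy : QueueAtt L y u v) (hz : QueueAtt L z u v) :
    L.lt u x ∧ L.lt x v := by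
  rcases hx.left_or_middle_or_right with h | h | h
  · have right : ∀ w, x ≠ w → QueueAtt L w u v → L.lt v w := by
      intro w hxw hw
      rcases hw.left_or_middle_or_right with h' | h' | h'
      · exact absurd ⟨h, h'⟩ (hx.not_both_left huv hxw hw)
      · exact absurd h'.2 (hx.2.not_nest hw.1.symm h h'.1)
      · exact h'
    exact absurd ⟨right y hxy hy, right z hxz hz⟩ (hy.not_both_right huv hyz hz)
  · exact h
  · have left : ∀ w, x ≠ w → QueueAtt L w u v → L.lt w u := by
      intro w hxw hw
      rcases hw.left_or_middle_or_right with h' | h' | h'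
      · exact h'
      · exact absurd h (hx.1.symm.not_nest hw.2 h'.1 h'.2)
      · exact absurd ⟨h, h'⟩ (hx.not_both_right huv hxw hw)
    exact absurd ⟨left y hxy hy, left z hxz hz⟩ (hy.not_both_left huv hyz hz)

end QueueAttachments

/-- If `a`, `b`, `c` are three distinct queue-attachments in `Ḡ(k,ℓ)` of an edge
`{u,v}` of `G(k-1,ℓ)` with `u ≺ v`, then all three lie strictly between `u` and `v`. -/
theorem queue_attachments_in_the_middle (k ℓ : ℕ) (hk : 1 < k) (hl : 2 < ℓ)
    (L : MixedLayout (Gkl k ℓ)) (u v a b c : PV ℓ)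
    (huv : (Gkl (k - 1) ℓ).Adj u v) (huvlt : L.lt u v)
    (hab : a ≠ b) (hac : a ≠ c) (hbc : b ≠ c)
    (ha : AttachedAt ℓ k a u v ∧ QueueAtt L a u v)
    (hb : AttachedAt ℓ k b u v ∧ QueueAtt L b u v)
    (hc : AttachedAt ℓ k c u v ∧ QueueAtt L c u v) :
    (L.lt u a ∧ L.lt a v) ∧ (L.lt u b ∧ L.lt b v) ∧ (L.lt u c ∧ L.lt c v) := by
  exact ⟨ha.2.middle huvlt hab hac hbc hb.2 hc.2,
    hb.2.middle huvlt hab.symm hbc hac ha.2 hc.2,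
    hc.2.middle huvlt hac.symm hbc.symm hab ha.2 hb.2⟩
end

section
/- Let G be a graph with a mixed 1-stack 1-queue layout, let u ≺ v be two vertices, and let a and b be two distinct vertices, each adjacent to both u and v, such that all four edges {a,u}, {a,v}, {b,u}, {b,v} are queue-edges. If a ≺ u, then v ≺ b. -/
/-- In a mixed layout of a graph `G`, if `u ≺ v` and `a ≠ b` are two vertices such
that all four edges `{a,u}`, `{a,v}`, `{b,u}`, `{b,v}` are queue-edges, then `a ≺ u`
implies `v ≺ b`. -/
theorem queue_attachment_side (V : Type) (G : SimpleGraph V) (L : MixedLayout G)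
    (u v a b : V) (huv : L.lt u v) (hab : a ≠ b)
    (hau : QEdgeIn L G a u) (hav : QEdgeIn L G a v)
    (hbu : QEdgeIn L G b u) (hbv : QEdgeIn L G b v)
    (h : L.lt a u) : L.lt v b := by
  have := L.isSTO
  rcases trichotomous_of L.lt v b with hvb | rfl | hbv'
  · exact hvb
  · exact absurd rfl hbv.1.ne
  rcases trichotomous_of L.lt u b with hub | rfl | hbu'
  · have hub_queue : ¬L.isStack s(u, b) := Sym2.eq_swap (a := b) (b := u) ▸ hbu.2
    exact absurd ⟨h, hub, hbv'⟩ (L.noNest a v u b hav.1 hbu.1.symm hav.2 hub_queue)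
  · exact absurd rfl hbu.1.ne
  rcases trichotomous_of L.lt a b with hlt | rfl | hlt
  · exact absurd ⟨hlt, hbu', huv⟩ (L.noNest a v b u hav.1 hbu.1 hav.2 hbu.2)
  · exact absurd rfl hab
  · exact absurd ⟨hlt, h, huv⟩ (L.noNest b v a u hbv.1 hau.1 hbv.2 hau.2)
end

section
/- Let L be a mixed 1-stack 1-queue layout of G(k,ℓ) with k > 4 and ℓ > 8. Then every queue-edge of the subgraph G(k-4,ℓ) has at least ℓ − 8 mixed-attachments among the ℓ vertices of Ḡ(k-3,ℓ) attached to it in L. -/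
/-! ### Combinatorics of stack-edges and queue-edges on a linearly ordered vertex set -/

/-- Two irreflexive symmetric relations on a linearly ordered type such that no two pairs of the
first cross and no two pairs of the second nest. -/
structure IsMixedPair {V : Type} [LinearOrder V] (S Q : V → V → Prop) : Prop where
  neS : ∀ a b, S a b → a ≠ b
  neQ : ∀ a b, Q a b → a ≠ b
  symmS : ∀ a b, S a b → S b a
  symmQ : ∀ a b, Q a b → Q b a
  noCross : ∀ a b c d, S a b → S c d → c ≤ a ∨ b ≤ c ∨ d ≤ b
  noNest : ∀ a b c d, Q a b → Q c d → c ≤ a ∨ d ≤ c ∨ b ≤ d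

/-- An increasing sequence `E` of symmetric relations, with levels on the vertices, in which each
pair of `E m` has `ℓ` common neighbours of level `m + 1` in `E (m + 1)`, and each vertex of level
`m + 1` has at most two neighbours in `E (m + 1)`. -/
structure IsAttachTower {V : Type} (ℓ : ℕ) (E : ℕ → V → V → Prop) (lev : V → ℕ) : Prop where
  symm : ∀ m a b, E m a b → E m b a
  mono : ∀ m n a b, m ≤ n → E m a b → E n a b
  lev_le : ∀ m a b, E m a b → lev a ≤ m
  nbrs : ∀ m y a b c, lev y = m + 1 → E (m + 1) y a → E (m + 1) y b → E (m + 1) y c →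
    a = b ∨ a = c ∨ b = c
  attach : ∀ m a b, E m a b → ∃ f : Fin ℓ → V, Function.Injective f ∧
    ∀ i, lev (f i) = m + 1 ∧ E (m + 1) (f i) a ∧ E (m + 1) (f i) b

namespace IsMixedPair

variable {V : Type} [LinearOrder V] {S Q : V → V → Prop}

/-- Of two stack-attachments of a pair, exactly one lies between its two vertices. -/
lemma inside_iff_not_inside (h : IsMixedPair S Q) {p q s t : V} (hpq : p < q) (hst : s ≠ t)
    (hsp : S s p) (hsq : S s q) (htp : S t p) (htq : S t q) :
    (p < s ∧ s < q) ↔ ¬ (p < t ∧ t < q) := by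
  wlog hlt : s < t generalizing s t
  · have := this hst.symm htp htq hsp hsq (lt_of_le_of_ne (not_lt.mp hlt) hst.symm)
    tauto
  have hps := h.symmS _ _ hsp
  have hqs := h.symmS _ _ hsq
  have hpt := h.symmS _ _ htp
  have hqt := h.symmS _ _ htq
  have n1 := h.neS _ _ hsp
  have n2 := h.neS _ _ hsq
  have n3 := h.neS _ _ htp
  have n4 := h.neS _ _ htq
  have h1 := h.noCross p t s q hpt hsq
  have h2 := h.noCross s p t q hsp htq
  have h3 := h.noCross p s q t hps hqt
  have h4 := h.noCross s q p t hsq hpt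
  grind (ematch := 0)

/-- A pair has at most two stack-attachments. -/
lemma card_stack_le_two (h : IsMixedPair S Q) {p q : V} (hpq : p ≠ q) (T : Finset V)
    (hT : ∀ x ∈ T, S x p ∧ S x q) : T.card ≤ 2 := by
  wlog hlt : p < q generalizing p q
  · exact this hpq.symm (fun x hx => (hT x hx).symm) (lt_of_le_of_ne (not_lt.mp hlt) hpq.symm)
  by_contra hc
  obtain ⟨a, ha, b, hb, c, hc, hab, hac, hbc⟩ := Finset.two_lt_card.mp (not_le.mp hc)
  have h1 := h.inside_iff_not_inside hlt hab (hT a ha).1 (hT a ha).2 (hT b hb).1 (hT b hb).2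
  have h2 := h.inside_iff_not_inside hlt hac (hT a ha).1 (hT a ha).2 (hT c hc).1 (hT c hc).2
  have h3 := h.inside_iff_not_inside hlt hbc (hT b hb).1 (hT b hb).2 (hT c hc).1 (hT c hc).2
  tauto

/-- A pair has at most one queue-attachment to the left of it. -/
lemma card_queue_left_le_one (h : IsMixedPair S Q) {u v : V} (huv : u < v) (T : Finset V)
    (hT : ∀ x ∈ T, Q x u ∧ Q x v ∧ x < u) : T.card ≤ 1 := by
  rw [Finset.card_le_one]
  intro a ha b hb
  have h1 := h.noNest a v b u (hT a ha).2.1 (hT b hb).1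
  have h2 := h.noNest b v a u (hT b hb).2.1 (hT a ha).1
  have := hT a ha
  have := hT b hb
  grind (ematch := 0)

/-- A pair has at most one queue-attachment to the right of it. -/
lemma card_queue_right_le_one (h : IsMixedPair S Q) {u v : V} (huv : u < v) (T : Finset V)
    (hT : ∀ x ∈ T, Q x u ∧ Q x v ∧ v < x) : T.card ≤ 1 := by
  rw [Finset.card_le_one]
  intro a ha b hb
  have h1 := h.noNest u a v b (h.symmQ _ _ (hT a ha).1) (h.symmQ _ _ (hT b hb).2.1)
  have h2 := h.noNest u b v a (h.symmQ _ _ (hT b hb).1) (h.symmQ _ _ (hT a ha).2.1)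
  have := hT a ha
  have := hT b hb
  grind (ematch := 0)

variable {ℓ : ℕ} {E : ℕ → V → V → Prop} {lev : V → ℕ}

/-- Each pair of the tower has three attachments that are not stack-attachments. -/
lemma exists_three_not_stack (h : IsMixedPair S Q) (hE : IsAttachTower ℓ E lev) (hl : 4 < ℓ)
    {m : ℕ} {a b : V} (hab : a ≠ b) (hm : E m a b) :
    ∃ g : Fin 3 → V, StrictMono g ∧ ∀ i, lev (g i) = m + 1 ∧ E (m + 1) (g i) a ∧
      E (m + 1) (g i) b ∧ ¬ (S (g i) a ∧ S (g i) b) := by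
  classical
  obtain ⟨f, hf, hf'⟩ := hE.attach m a b hm
  set U := Finset.univ.image f with hU
  have hUc : U.card = ℓ := by simp [hU, Finset.card_image_of_injective _ hf]
  have h2 := h.card_stack_le_two hab (U.filter fun x => S x a ∧ S x b) (by simp)
  have h3 := Finset.card_filter_add_card_filter_not (s := U) (fun x => S x a ∧ S x b)
  have h4 : 3 ≤ (U.filter fun x => ¬ (S x a ∧ S x b)).card := by omega
  refine ⟨Finset.orderEmbOfCardLe _ h4, (Finset.orderEmbOfCardLe _ h4).strictMono, fun i => ?_⟩
  have := Finset.orderEmbOfCardLe_mem _ h4 i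
  simp only [Finset.mem_filter, hU, Finset.mem_image, Finset.mem_univ, true_and] at this
  obtain ⟨⟨j, hj⟩, hn⟩ := this
  have := hf' j
  rw [hj] at this
  exact ⟨this.1, this.2.1, this.2.2, hn⟩

/-- There is no smiley face: if `b` and `c` are joined by queue-edges to the left and right end
of a queue-edge `{u,v}`, no edge of the last but one level lies between `b` and `c`. -/
lemma no_smiley (h : IsMixedPair S Q) (hE : IsAttachTower ℓ E lev) (hl : 4 < ℓ)
    {n : ℕ} (hSQ : ∀ a b, E (n + 1) a b → S a b ∨ Q a b) {u v b c p q : V}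
    (huv : Q u v) (hu : lev u ≤ n) (hv : lev v ≤ n) (hub : Q u b) (hcv : Q c v)
    (h1 : u < b) (h2 : b < p) (h3 : p < q) (h4 : q < c) (h5 : c < v) (hpq : E n p q) : False := by
  obtain ⟨g, hg, hg'⟩ := h.exists_three_not_stack hE hl h3.ne hpq
  obtain ⟨hl, hp, hq, hn⟩ := hg' 0
  generalize g 0 = t at *
  have a1 : ∀ r, b < r → r < c → E (n + 1) t r → S t r := by
    intro r hr1 hr2 htr
    refine (hSQ t r htr).resolve_right fun hQ => ?_
    have hQ' := h.symmQ _ _ hQ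
    have := h.neQ _ _ hQ
    have := h.noNest t r u b hQ hub
    have := h.noNest r t c v hQ' hcv
    have := h.noNest u v t r huv hQ
    have := h.noNest u v r t huv hQ'
    grind (ematch := 0)
  exact hn ⟨a1 p h2 (h3.trans h4) hp, a1 q (h2.trans h3) h4 hq⟩

/-- A queue-edge does not have five queue-attachments between its ends, provided there are three
more levels of attachments. -/
lemma no_five_inside (h : IsMixedPair S Q) (hE : IsAttachTower ℓ E lev) (hl : 4 < ℓ)
    {n : ℕ} (hSQ : ∀ a b, E (n + 3) a b → S a b ∨ Q a b) {u v : V} (huv : Q u v)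
    (x : Fin 5 → V) (hx : StrictMono x) (hux : u < x 0) (hxv : x 4 < v)
    (hEu : ∀ i, E n (x i) u) (hEv : ∀ i, E n (x i) v)
    (hQu : ∀ i, Q (x i) u) (hQv : ∀ i, Q (x i) v) : False := by
  have hlx : ∀ i, lev (x i) ≤ n := fun i => hE.lev_le _ _ _ (hEu i)
  have hlu : lev u ≤ n := hE.lev_le _ _ _ (hE.symm _ _ _ (hEu 0))
  have hlv : lev v ≤ n := hE.lev_le _ _ _ (hE.symm _ _ _ (hEv 0))
  have h01 : x 0 < x 1 := hx (by decide)
  have h12 : x 1 < x 2 := hx (by decide)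
  have h23 : x 2 < x 3 := hx (by decide)
  have h34 : x 3 < x 4 := hx (by decide)
  have hQu' : ∀ i, Q u (x i) := fun i => h.symmQ _ _ (hQu i)
  have noE : ∀ b p q, Q u b → u < b → b < p → p < q → q < x 4 → ¬ E (n + 2) p q :=
    fun b p q hub h1 h2 h3 h4 hpq => h.no_smiley hE hl hSQ huv (by omega) (by omega) hub (hQv 4)
      h1 h2 h3 h4 hxv hpq
  -- vertices of late levels adjacent to a middle vertex `m` lie outside and form stack-edges
  have outside : ∀ m y, x 0 < m → m < x 4 → E (n + 2) y m → n < lev y →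
      (y < x 0 ∨ x 4 < y) ∧ y ≠ u ∧ y ≠ v := by
    intro m y hm hm' hy hly
    have n1 : y ≠ u := by rintro rfl; omega
    have n2 : y ≠ v := by rintro rfl; omega
    have n3 : y ≠ x 0 := by rintro rfl; have := hlx 0; omega
    have n4 : y ≠ x 4 := by rintro rfl; have := hlx 4; omega
    have n5 : y ≠ m := by
      rcases hSQ _ _ (hE.mono _ _ _ _ (by omega) hy) with hy | hy
      · exact h.neS _ _ hy
      · exact h.neQ _ _ hy
    have hl := noE (x 0) y m (hQu' 0) hux
    have hr := noE (x 0) m y (hQu' 0) hux hm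
    have hy' := hE.symm _ _ _ hy
    refine ⟨?_, n1, n2⟩
    by_contra! hc
    rcases lt_or_gt_of_ne n5 with h' | h'
    · exact hl (lt_of_le_of_ne hc.1 n3.symm) h' hm' hy
    · exact hr h' (lt_of_le_of_ne hc.2 n4) hy'
  have stack : ∀ m y, x 0 < m → m < x 4 → E (n + 3) y m → y ≠ u → y ≠ v →
      (y < x 0 ∨ x 4 < y) → S y m := by
    intro m y hm hm' hy hyu hyv hy'
    refine (hSQ y m hy).resolve_right fun hQ => ?_
    have hQ' := h.symmQ _ _ hQ
    have := h.noNest y m u (x 0) hQ (hQu' 0)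
    have := h.noNest m y (x 4) v hQ' (hQv 4)
    have := h.noNest u v y m huv hQ
    have := h.noNest u v m y huv hQ'
    grind (ematch := 0)
  -- attachments to `{x i, u}` joined to `x i` by a stack-edge and to `u` by a queue-edge
  have attU : ∀ i, 0 < i → i < 4 → ∃ y, lev y = n + 1 ∧ E (n + 1) y (x i) ∧ E (n + 1) y u ∧ S y (x i) ∧
      Q y u ∧ (y < u ∨ (x 4 < y ∧ y < v)) := by
    intro i hi hi'
    have hm : x 0 < x i := hx hi
    have hm' : x i < x 4 := hx hi'
    obtain ⟨g, hg, hg'⟩ := h.exists_three_not_stack hE hl (h.neQ _ _ (hQu i)) (hEu i)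
    have key : ∀ j, S (g j) (x i) ∧ Q (g j) u ∧ g j < v ∧ g j ≠ u ∧ (g j < x 0 ∨ x 4 < g j) := by
      intro j
      obtain ⟨l1, l2, l3, l4⟩ := hg' j
      obtain ⟨o1, o2, o3⟩ := outside _ _ hm hm' (hE.mono _ _ _ _ (by omega) l2) (by omega)
      have s1 := stack _ _ hm hm' (hE.mono _ _ _ _ (by omega) l2) o2 o3 o1
      have q1 : Q (g j) u := (hSQ _ _ (hE.mono _ _ _ _ (by omega) l3)).resolve_left
        fun hs => l4 ⟨s1, hs⟩
      have := h.noNest u (g j) (x i) v (h.symmQ _ _ q1) (hQv i)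
      exact ⟨s1, q1, by grind, o2, o1⟩
    have hg01 : g 0 < g 1 := hg (by decide)
    have := noE (g 0) (g 1) (x i) (h.symmQ _ _ (key 0).2.1)
    have k0 := key 0
    have k1 := key 1
    have : ¬ (u < g 0 ∧ g 1 < x 0) := by
      rintro ⟨h1, h2⟩
      exact this h1 hg01 (h2.trans hm) hm' (hE.mono _ _ _ _ (by omega) (hg' 1).2.1)
    by_cases hB : u < g 0 ∧ g 0 < x 0
    · exact ⟨g 1, (hg' 1).1, (hg' 1).2.1, (hg' 1).2.2.1, k1.1, k1.2.1, by grind⟩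
    · exact ⟨g 0, (hg' 0).1, (hg' 0).2.1, (hg' 0).2.2.1, k0.1, k0.2.1, by grind⟩
  -- attachments to `{y, x i}` joined to `x i` by stack-edges and to `y` by queue-edges
  have attY : ∀ i y, 0 < i → i < 4 → lev y = n + 1 → E (n + 1) y (x i) → S y (x i) →
      ∃ g : Fin 3 → V, StrictMono g ∧ ∀ j, lev (g j) = n + 2 ∧ E (n + 2) (g j) (x i) ∧
        S (g j) (x i) ∧ Q (g j) y ∧ g j ≠ u ∧ g j ≠ v ∧ (g j < x 0 ∨ x 4 < g j) := by
    intro i y hi hi' hy hyx hS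
    have hm : x 0 < x i := hx hi
    have hm' : x i < x 4 := hx hi'
    obtain ⟨g, hg, hg'⟩ := h.exists_three_not_stack hE hl (h.neS _ _ hS) hyx
    refine ⟨g, hg, fun j => ?_⟩
    obtain ⟨l1, l2, l3, l4⟩ := hg' j
    obtain ⟨o1, o2, o3⟩ := outside _ _ hm hm' l3 (by omega)
    have s1 := stack _ _ hm hm' (hE.mono _ _ _ _ (by omega) l3) o2 o3 o1
    exact ⟨l1, l3, s1, (hSQ _ _ (hE.mono _ _ _ _ (by omega) l2)).resolve_left
        fun hs => l4 ⟨hs, s1⟩, o2, o3, o1⟩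
  -- the vertex `x 3` has a stack-neighbour outside of the interval from `u` to `v`
  obtain ⟨p, hpS, hp⟩ : ∃ p, S p (x 3) ∧ (p < u ∨ v < p) := by
    obtain ⟨y, ly, Ey, -, Sy, Qy, hy⟩ := attU 3 (by decide) (by decide)
    rcases hy with hy | hy
    · exact ⟨y, Sy, Or.inl hy⟩
    obtain ⟨g, hg, hg'⟩ := attY 3 y (by decide) (by decide) ly Ey Sy
    obtain ⟨l1, l2, l3, l4, l5, l6, l7⟩ := hg' 0
    refine ⟨g 0, l3, ?_⟩
    have := h.noNest u v (g 0) y huv l4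
    have := h.noNest u v y (g 0) huv (h.symmQ _ _ l4)
    have := h.neQ _ _ l4
    grind (ematch := 0)
  obtain ⟨y, ly, Ey, Sy, Qy, hy⟩ : ∃ y, lev y = n + 1 ∧ E (n + 1) y (x 2) ∧ S y (x 2) ∧
      Q y u ∧ y < u := by
    obtain ⟨y, ly, Ey, -, Sy, Qy, hy⟩ := attU 2 (by decide) (by decide)
    refine ⟨y, ly, Ey, Sy, Qy, hy.resolve_right fun hy => ?_⟩
    have := h.noCross (x 2) y (x 3) p (h.symmS _ _ Sy) (h.symmS _ _ hpS)
    have := h.noCross p (x 3) (x 2) y hpS (h.symmS _ _ Sy)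
    grind (ematch := 0)
  obtain ⟨z, lz, Ez, Ezu, Sz, Qz, hz⟩ : ∃ z, lev z = n + 1 ∧ E (n + 1) z (x 1) ∧
      E (n + 1) z u ∧ S z (x 1) ∧ Q z u ∧ z < u := by
    obtain ⟨z, lz, Ez, Ezu, Sz, Qz, hz⟩ := attU 1 (by decide) (by decide)
    refine ⟨z, lz, Ez, Ezu, Sz, Qz, hz.resolve_right fun hz => ?_⟩
    have := h.noCross y (x 2) (x 1) z Sy (h.symmS _ _ Sz)
    grind (ematch := 0)
  obtain ⟨g, hg, hg'⟩ := attY 1 z (by decide) (by decide) lz Ez Sz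
  have inB : ∀ j, u < g j ∧ g j < x 0 := by
    intro j
    obtain ⟨l1, l2, l3, l4, l5, l6, l7⟩ := hg' j
    have l4' := h.symmQ _ _ l4
    have : g j ≠ y := by intro h; rw [h] at l1; omega
    have := h.noCross (g j) (x 1) y (x 2) l3 Sy
    have := h.noCross z (x 1) y (x 2) Sz Sy
    have := h.noNest y u (g j) z Qy l4
    have := h.noNest y u z (g j) Qy l4'
    have := h.neQ _ _ l4
    have := h.noNest z (g j) u (x 0) l4' (hQu' 0)
    have : y ≠ z := by
      rintro rfl
      rcases hE.nbrs n y _ _ _ ly Ey Ez Ezu with h' | h' | h'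
      · exact h12.ne' h'
      · exact h.neQ _ _ (hQu 2) h'
      · exact h.neQ _ _ (hQu 1) h'
    grind (ematch := 0)
  have hg01 : g 0 < g 1 := hg (by decide)
  have hg12 : g 1 < g 2 := hg (by decide)
  obtain ⟨f, hf, hf'⟩ := h.exists_three_not_stack hE hl (h.neS _ _ (hg' 1).2.2.1) (hg' 1).2.1
  obtain ⟨l1, l2, l3, l4⟩ := hf' 0
  generalize f 0 = s at *
  have b0 := inB 0
  have b1 := inB 1
  have b2 := inB 2
  have nu : s ≠ u := by rintro rfl; omega
  have nv : s ≠ v := by rintro rfl; omega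
  have nz : s ≠ z := by rintro rfl; omega
  have q0 := (hg' 0).2.2.2.1
  have q2 := h.symmQ _ _ (hg' 2).2.2.2.1
  have ns1 : S s (x 1) := by
    refine (hSQ _ _ l3).resolve_right fun hQ => ?_
    have hQ' := h.symmQ _ _ hQ
    have := h.neQ _ _ hQ
    have := h.noNest s (x 1) u (x 0) hQ (hQu' 0)
    have := h.noNest (x 1) s (x 4) v hQ' (hQv 4)
    have := h.noNest u v s (x 1) huv hQ
    have := h.noNest u v (x 1) s huv hQ'
    grind (ematch := 0)
  have qs : Q s (g 1) := (hSQ _ _ l2).resolve_left fun hs => l4 ⟨hs, ns1⟩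
  have qs' := h.symmQ _ _ qs
  have := h.neQ _ _ qs
  have := h.noNest u v s (g 1) huv qs
  have := h.noNest u v (g 1) s huv qs'
  have := h.noNest (g 1) s (x 4) v qs' (hQv 4)
  have := h.noNest s (g 1) z (g 0) qs (h.symmQ _ _ q0)
  have := h.noNest z (g 2) s (g 1) q2 qs
  grind (ematch := 0)

open Classical in
/-- Among the attachments of a queue-edge, at least `ℓ - 8` are mixed. -/
lemma card_mixed (h : IsMixedPair S Q) (hE : IsAttachTower ℓ E lev) (hl : 4 < ℓ)
    {n : ℕ} (hSQ : ∀ a b, E (n + 3) a b → S a b ∨ Q a b) {u v : V} (huv : Q u v) (T : Finset V)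
    (hT : ∀ x ∈ T, E n x u ∧ E n x v) :
    T.card ≤ (T.filter fun x => (S x u ∧ Q x v) ∨ (Q x u ∧ S x v)).card + 8 := by
  wlog hlt : u < v generalizing u v
  · have := this (h.symmQ _ _ huv) (fun x hx => (hT x hx).symm)
      (lt_of_le_of_ne (not_lt.mp hlt) (h.neQ _ _ huv).symm)
    simp only [and_comm (a := S _ v), and_comm (a := Q _ v)] at this
    simpa only [or_comm] using this
  have c1 := h.card_stack_le_two hlt.ne {x ∈ T | S x u ∧ S x v} (by simp)
  have c2 := h.card_queue_left_le_one hlt {x ∈ T | Q x u ∧ Q x v ∧ x < u} (by simp)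
  have c3 := h.card_queue_right_le_one hlt {x ∈ T | Q x u ∧ Q x v ∧ v < x} (by simp)
  have c4 : {x ∈ T | Q x u ∧ Q x v ∧ u < x ∧ x < v}.card ≤ 4 := by
    by_contra! hc
    have hmem : ∀ i, _ := Finset.orderEmbOfCardLe_mem _ (Nat.succ_le_of_lt hc)
    simp only [Finset.mem_filter] at hmem
    exact h.no_five_inside hE hl hSQ huv _ (Finset.orderEmbOfCardLe _ hc).strictMono
      (hmem 0).2.2.2.1 (hmem 4).2.2.2.2 (fun i => (hT _ (hmem i).1).1)
      (fun i => (hT _ (hmem i).1).2) (fun i => (hmem i).2.1) (fun i => (hmem i).2.2.1)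
  have hsub : T ⊆ {x ∈ T | (S x u ∧ Q x v) ∨ (Q x u ∧ S x v)} ∪ ({x ∈ T | S x u ∧ S x v} ∪
      ({x ∈ T | Q x u ∧ Q x v ∧ x < u} ∪ ({x ∈ T | Q x u ∧ Q x v ∧ v < x} ∪
        {x ∈ T | Q x u ∧ Q x v ∧ u < x ∧ x < v}))) := by
    intro x hx
    have s1 := hSQ _ _ (hE.mono n (n + 3) _ _ (by omega) (hT x hx).1)
    have s2 := hSQ _ _ (hE.mono n (n + 3) _ _ (by omega) (hT x hx).2)
    have n1 := h.neQ x u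
    have n2 := h.neQ x v
    simp only [Finset.mem_union, Finset.mem_filter, hx, true_and]
    rcases lt_trichotomy x u with h1 | h1 | h1 <;> rcases lt_trichotomy x v with h2 | h2 | h2 <;>
      tauto
  have d0 := Finset.card_le_card hsub
  have d1 := Finset.card_union_le {x ∈ T | (S x u ∧ Q x v) ∨ (Q x u ∧ S x v)}
    ({x ∈ T | S x u ∧ S x v} ∪ ({x ∈ T | Q x u ∧ Q x v ∧ x < u} ∪
      ({x ∈ T | Q x u ∧ Q x v ∧ v < x} ∪ {x ∈ T | Q x u ∧ Q x v ∧ u < x ∧ x < v})))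
  have d2 := Finset.card_union_le {x ∈ T | S x u ∧ S x v}
    ({x ∈ T | Q x u ∧ Q x v ∧ x < u} ∪
      ({x ∈ T | Q x u ∧ Q x v ∧ v < x} ∪ {x ∈ T | Q x u ∧ Q x v ∧ u < x ∧ x < v}))
  have d3 := Finset.card_union_le {x ∈ T | Q x u ∧ Q x v ∧ x < u}
    ({x ∈ T | Q x u ∧ Q x v ∧ v < x} ∪ {x ∈ T | Q x u ∧ Q x v ∧ u < x ∧ x < v})
  have d4 := Finset.card_union_le {x ∈ T | Q x u ∧ Q x v ∧ v < x}
    {x ∈ T | Q x u ∧ Q x v ∧ u < x ∧ x < v}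
  omega

end IsMixedPair

/-! ### The graphs `G(k,ℓ)` -/

/-- The step at which a vertex is attached. -/
def PV.level {ℓ : ℕ} : PV ℓ → ℕ
  | .A => 0
  | .B => 0
  | .att k _ _ _ => k

lemma Gedges_mono_s8 (ℓ : ℕ) : Monotone (Gedges ℓ) := by
  refine monotone_nat_of_le_succ fun k => ?_
  match k with
  | 0 => exact Set.empty_subset _
  | k + 1 => exact Set.subset_union_left

lemma Gedges_level_le {ℓ : ℕ} : ∀ {m : ℕ} {p : PV ℓ × PV ℓ}, p ∈ Gedges ℓ m →
    p.1.level ≤ m ∧ p.2.level ≤ m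
  | 0, _, hp => hp.elim
  | 1, p, hp => by
    have hp : p = (PV.A, PV.B) := hp
    subst hp
    simp [PV.level]
  | m + 2, p, hp => by
    rcases hp with hp | ⟨u, v, i, huv, rfl | rfl⟩
    · have := Gedges_level_le hp
      omega
    · have := Gedges_level_le huv
      simp only [PV.level] at *
      omega
    · have := Gedges_level_le huv
      simp only [PV.level] at *
      omega

lemma Gedges_ne {ℓ : ℕ} : ∀ {m : ℕ} {p : PV ℓ × PV ℓ}, p ∈ Gedges ℓ m → p.1 ≠ p.2
  | 0, _, hp => hp.elim
  | 1, p, hp => by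
    have hp : p = (PV.A, PV.B) := hp
    subst hp
    simp
  | m + 2, p, hp => by
    rcases hp with hp | ⟨u, v, i, huv, rfl | rfl⟩
    · exact Gedges_ne hp
    · have := (Gedges_level_le huv).1
      intro h
      have := congrArg PV.level h
      simp only [PV.level] at *
      omega
    · have := (Gedges_level_le huv).2
      intro h
      have := congrArg PV.level h
      simp only [PV.level] at *
      omega

lemma Gedges_finite (ℓ : ℕ) : ∀ m, (Gedges ℓ m).Finite
  | 0 => Set.finite_empty
  | 1 => Set.finite_singleton _
  | m + 2 => by
    have ih := Gedges_finite ℓ (m + 1)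
    refine ih.union ?_
    have h1 := (ih.prod (Set.finite_univ (α := Fin ℓ)))
    refine ((h1.image fun t => (PV.att (m + 2) t.1.1 t.1.2 t.2, t.1.1)).union
      (h1.image fun t => (PV.att (m + 2) t.1.1 t.1.2 t.2, t.1.2))).subset ?_
    rintro p ⟨u, v, i, huv, rfl | rfl⟩
    · exact Or.inl ⟨((u, v), i), ⟨huv, trivial⟩, rfl⟩
    · exact Or.inr ⟨((u, v), i), ⟨huv, trivial⟩, rfl⟩

lemma Gkl_adj {k ℓ : ℕ} {a b : PV ℓ} :
    (Gkl k ℓ).Adj a b ↔ (a, b) ∈ Gedges ℓ k ∨ (b, a) ∈ Gedges ℓ k := by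
  simp only [Gkl, SimpleGraph.fromEdgeSet_adj, Set.mem_image, Prod.exists, Sym2.eq_iff]
  constructor
  · rintro ⟨⟨c, d, h, ⟨rfl, rfl⟩ | ⟨rfl, rfl⟩⟩, -⟩
    · exact Or.inl h
    · exact Or.inr h
  · rintro (h | h)
    · exact ⟨⟨a, b, h, Or.inl ⟨rfl, rfl⟩⟩, Gedges_ne h⟩
    · exact ⟨⟨b, a, h, Or.inr ⟨rfl, rfl⟩⟩, (Gedges_ne h).symm⟩

/-- In `G(m+1,ℓ)`, the neighbours of a vertex attached at the last step are the ends of the edge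
it is attached to. -/
lemma Gkl_adj_of_level {ℓ m : ℕ} {y : PV ℓ} (hy : y.level = m + 1) :
    ∃ p q, ∀ a, (Gkl (m + 1) ℓ).Adj y a → a = p ∨ a = q := by
  match y, hy with
  | .att _ p q i, rfl =>
    refine ⟨p, q, fun a ha => ?_⟩
    rw [Gkl_adj] at ha
    match m, ha with
    | 0, ha =>
      have ha : (PV.att 1 p q i, a) = (PV.A, PV.B) ∨ (a, PV.att 1 p q i) = (PV.A, PV.B) := ha
      simp at ha
    | m + 1, ha =>
      rcases ha with (ha | ⟨u, v, j, huv, ha⟩) | (ha | ⟨u, v, j, huv, ha⟩)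
      · have := (Gedges_level_le ha).1
        simp [PV.level] at this
      · simp only [Prod.mk.injEq, PV.att.injEq] at ha
        grind
      · have := (Gedges_level_le ha).2
        simp [PV.level] at this
      · have := Gedges_level_le huv
        rcases ha with ha | ha <;> obtain ⟨-, rfl⟩ := Prod.mk.inj ha <;>
          simp [PV.level] at this

lemma Gkl_attach {ℓ m : ℕ} {a b : PV ℓ} (hab : (Gkl m ℓ).Adj a b) :
    ∃ f : Fin ℓ → PV ℓ, Function.Injective f ∧ ∀ i, (f i).level = m + 1 ∧
      (Gkl (m + 1) ℓ).Adj (f i) a ∧ (Gkl (m + 1) ℓ).Adj (f i) b := by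
  match m with
  | 0 => exact ((Gkl_adj.mp hab).elim id id).elim
  | m + 1 =>
    simp only [Gkl_adj] at *
    rcases hab with hab | hab
    · refine ⟨PV.att (m + 2) a b, fun i j hij => by simpa using hij, fun i => ⟨rfl, ?_, ?_⟩⟩
      · exact Or.inl (Or.inr ⟨a, b, i, hab, Or.inl rfl⟩)
      · exact Or.inl (Or.inr ⟨a, b, i, hab, Or.inr rfl⟩)
    · refine ⟨PV.att (m + 2) b a, fun i j hij => by simpa using hij, fun i => ⟨rfl, ?_, ?_⟩⟩
      · exact Or.inl (Or.inr ⟨b, a, i, hab, Or.inr rfl⟩)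
      · exact Or.inl (Or.inr ⟨b, a, i, hab, Or.inl rfl⟩)

lemma Gkl_isAttachTower (ℓ : ℕ) : IsAttachTower ℓ (fun m => (Gkl m ℓ).Adj) PV.level where
  symm _ _ _ h := h.symm
  mono m n a b hmn h := by
    rw [Gkl_adj] at *
    exact h.imp (fun h => Gedges_mono_s8 ℓ hmn h) (fun h => Gedges_mono_s8 ℓ hmn h)
  lev_le m a b h := by
    rcases Gkl_adj.mp h with h | h
    · exact (Gedges_level_le h).1
    · exact (Gedges_level_le h).2
  nbrs m y a b c hy ha hb hc := by
    obtain ⟨p, q, hpq⟩ := Gkl_adj_of_level hy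
    have := hpq a ha
    have := hpq b hb
    have := hpq c hc
    grind
  attach m a b h := Gkl_attach h

lemma Gbar_adj_of_level {ℓ m : ℕ} {x a : PV ℓ} (hx : x.level = m + 1)
    (h : (Gkl (m + 1) ℓ).Adj x a) : (Gbar (m + 1) ℓ).Adj x a := by
  have hne := h.ne
  rw [Gkl_adj] at h
  rw [Gbar, SimpleGraph.fromEdgeSet_adj]
  refine ⟨?_, hne⟩
  rcases h with h | h
  · refine ⟨(x, a), ⟨h, fun h' => ?_⟩, rfl⟩
    have := (Gedges_level_le h').1
    simp only at this
    omega
  · refine ⟨(a, x), ⟨h, fun h' => ?_⟩, Sym2.eq_swap⟩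
    have := (Gedges_level_le h').2
    simp only at this
    omega

lemma finite_setOf_attachedAt (ℓ k : ℕ) (u v : PV ℓ) : {x | AttachedAt ℓ k x u v}.Finite := by
  have h := Gedges_finite ℓ k
  refine ((h.image Prod.fst).union (h.image Prod.snd)).subset ?_
  rintro x ⟨hx, -⟩
  rw [Gbar, SimpleGraph.fromEdgeSet_adj] at hx
  obtain ⟨⟨⟨c, d⟩, ⟨hcd, -⟩, he⟩, -⟩ := hx
  rcases Sym2.eq_iff.mp he with ⟨rfl, rfl⟩ | ⟨rfl, rfl⟩
  · exact Or.inl ⟨_, hcd, rfl⟩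
  · exact Or.inr ⟨_, hcd, rfl⟩

/-- The stack-edges and queue-edges of a mixed layout form a mixed pair with respect to any linear
order that agrees with the order of the layout. -/
lemma MixedLayout.isMixedPair {V : Type} [LinearOrder V] {G : SimpleGraph V} (L : MixedLayout G)
    (hlt : ∀ a b, L.lt a b ↔ a < b) : IsMixedPair (SEdgeIn L G) (QEdgeIn L G) where
  neS _ _ h := h.1.ne
  neQ _ _ h := h.1.ne
  symmS _ _ h := ⟨h.1.symm, by rw [Sym2.eq_swap]; exact h.2⟩
  symmQ _ _ h := ⟨h.1.symm, by rw [Sym2.eq_swap]; exact h.2⟩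
  noCross a b c d hab hcd := by
    have := L.noCross a b c d hab.1 hcd.1 hab.2 hcd.2
    simp only [hlt] at this
    grind
  noNest a b c d hab hcd := by
    have := L.noNest a b c d hab.1 hcd.1 hab.2 hcd.2
    simp only [hlt] at this
    grind

/-- Every queue-edge of `G(k-4,ℓ)` has at least `ℓ - 8` mixed-attachments among the
vertices of `Ḡ(k-3,ℓ)` attached to it. -/
theorem many_mixed_attachments (k ℓ : ℕ) (hk : 4 < k) (hl : 8 < ℓ)
    (L : MixedLayout (Gkl k ℓ)) (u v : PV ℓ)
    (huv : QEdgeIn L (Gkl (k - 4) ℓ) u v) :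
    ℓ - 8 ≤ {x : PV ℓ | AttachedAt ℓ (k - 3) x u v ∧ MixedAtt L x u v}.ncard := by
  classical
  obtain ⟨n, rfl⟩ : ∃ n, k = n + 4 := ⟨k - 4, by omega⟩
  have e1 : n + 4 - 4 = n := by omega
  have e2 : n + 4 - 3 = n + 1 := by omega
  rw [e1] at huv
  rw [e2]
  have := L.isSTO
  let _ : LinearOrder (PV ℓ) := linearOrderOfSTO L.lt
  have hL := L.isMixedPair fun _ _ => Iff.rfl
  have hE := Gkl_isAttachTower ℓ
  obtain ⟨f, hf, hf'⟩ := Gkl_attach huv.1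
  have hSQ : ∀ a b, (Gkl (n + 1 + 3) ℓ).Adj a b →
      SEdgeIn L (Gkl (n + 4) ℓ) a b ∨ QEdgeIn L (Gkl (n + 4) ℓ) a b := fun a b hab =>
    (em (L.isStack s(a, b))).imp (fun h => ⟨hab, h⟩) (fun h => ⟨hab, h⟩)
  have huv' : QEdgeIn L (Gkl (n + 4) ℓ) u v := ⟨hE.mono _ _ _ _ (by omega) huv.1, huv.2⟩
  have key := hL.card_mixed hE (by omega) hSQ huv' (Finset.univ.image f)
    (by simpa using fun i => (hf' i).2)
  rw [Finset.card_image_of_injective _ hf, Finset.card_univ, Fintype.card_fin] at key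
  refine (Nat.sub_le_of_le_add key).trans ?_
  rw [← Set.ncard_coe_finset]
  refine Set.ncard_le_ncard ?_ ((finite_setOf_attachedAt ℓ (n + 1) u v).subset fun x hx => hx.1)
  intro x hx
  simp only [Finset.coe_filter, Finset.mem_image, Finset.mem_univ, true_and, Set.mem_ofPred_eq] at hx
  obtain ⟨⟨i, rfl⟩, hx⟩ := hx
  obtain ⟨l, h1, h2⟩ := hf' i
  exact ⟨⟨Gbar_adj_of_level l h1, Gbar_adj_of_level l h2⟩, hx⟩
end
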